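/- arXiv:1602.00168 — 2 statements merged into one kernel-verified Lean document; each statement's English description precedes it below -/
import Mathlib

section
/- (Inversion formula: F is its own inverse.) Let u : [0,∞) → ℝ be smooth with compact support, and define Fu(ξ) = ∫₀^∞ K(ξx)·u(x)·x^{N/2−1} dx for ξ ≥ 0. Then the function ξ ↦ K(ξx)·Fu(ξ)·ξ^{N/2−1} is integrable on (0,∞) for every x ≥ 0, and F(Fu)(x) = u(x) for all x ≥ 0. -/
open Set Real MeasureTheory

/-- The entire function `K(X) = 2^{N/2} Σ_{k≥0} (−4X)^k/(k!·Γ(N/2+k))`. -/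
noncomputable def Kfun (N : ℝ) (X : ℝ) : ℝ :=
  ∑' k : ℕ, 2 ^ (N/2) * (-4 * X) ^ k / (k.factorial * Real.Gamma (N/2 + k))

/-- The transform `Fu(ξ) = ∫₀^∞ K(ξx)·u(x)·x^{N/2−1} dx`. -/
noncomputable def Ftrans (N : ℝ) (u : ℝ → ℝ) (ξ : ℝ) : ℝ :=
  ∫ x in Ioi (0:ℝ), Kfun N (ξ * x) * u x * x ^ (N/2 - 1)

lemma Gamma_le_Gamma_add_nat {s : ℝ} (hs : 1 ≤ s) (k : ℕ) :
    Real.Gamma s ≤ Real.Gamma (s + k) := by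
  induction k with
  | zero => simp
  | succ k ih =>
    have hk : (0 : ℝ) ≤ k := k.cast_nonneg
    have h : Real.Gamma (s + k + 1) = (s + k) * Real.Gamma (s + k) :=
      Real.Gamma_add_one (by linarith)
    have hp : 0 < Real.Gamma (s + k) := Real.Gamma_pos_of_pos (by linarith)
    push_cast
    rw [← add_assoc, h]
    nlinarith

/-- The `k`-th term of the series defining `Kfun`. -/
noncomputable def Kterm (N : ℝ) (k : ℕ) (X : ℝ) : ℝ :=
  2 ^ (N/2) * (-4 * X) ^ k / (k.factorial * Real.Gamma (N/2 + k))

lemma abs_Kterm_le {N : ℝ} (hN : 2 ≤ N) {R X : ℝ} (hX : |X| ≤ R) (k : ℕ) :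
    |Kterm N k X| ≤ 2 ^ (N/2) / Real.Gamma (N/2) * ((4 * R) ^ k / k.factorial) := by
  have h1 := Gamma_le_Gamma_add_nat (s := N/2) (by linarith) k
  have h0 : 0 < Real.Gamma (N/2) := Real.Gamma_pos_of_pos (by linarith)
  have hR : 0 ≤ R := (abs_nonneg X).trans hX
  have hG : 0 < Real.Gamma (N/2 + k) := h0.trans_le h1
  have e : |Kterm N k X| = 2 ^ (N/2) / Real.Gamma (N/2 + k) * ((4 * |X|) ^ k / k.factorial) := by
    unfold Kterm
    rw [abs_div, abs_mul, abs_mul, abs_pow, abs_mul, abs_of_pos hG, Nat.abs_cast,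
      abs_of_pos (by positivity : (0:ℝ) < 2 ^ (N/2))]
    simp only [abs_neg, Nat.abs_ofNat]
    field_simp
  rw [e]
  gcongr

lemma summable_Kterm {N : ℝ} (hN : 2 ≤ N) (X : ℝ) : Summable fun k => Kterm N k X :=
  .of_norm_bounded ((Real.summable_pow_div_factorial (4 * |X|)).mul_left _)
    fun k => abs_Kterm_le hN le_rfl k

lemma hasDerivAt_Kterm_zero (N X : ℝ) : HasDerivAt (Kterm N 0) 0 X := by
  have : Kterm N 0 = fun _ => Kterm N 0 0 := by ext; simp [Kterm]
  rw [this]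
  exact hasDerivAt_const _ _

lemma hasDerivAt_Kterm_succ (N X : ℝ) (k : ℕ) :
    HasDerivAt (Kterm N (k + 1)) (-2 * Kterm (N + 2) k X) X := by
  have h := (((hasDerivAt_id X).const_mul (-4)).pow (k + 1)).const_mul ((2:ℝ) ^ (N/2))
    |>.div_const ((k + 1).factorial * Real.Gamma (N/2 + (k + 1 : ℕ)))
  refine h.congr_deriv ?_
  have e : (2:ℝ) ^ ((N + 2) / 2) = 2 ^ (N/2) * 2 := by
    rw [show (N + 2) / 2 = N/2 + 1 by ring, rpow_add_one (by norm_num)]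
  have e' : (N + 2) / 2 + (k:ℝ) = N/2 + (k + 1 : ℕ) := by push_cast; ring
  rw [Kterm, e, e', Nat.factorial_succ]
  have : (k.factorial : ℝ) ≠ 0 := by positivity
  by_cases hG : Real.Gamma (N/2 + (k + 1 : ℕ)) = 0
  · rw [hG]; simp
  simp only [id, Nat.cast_mul, add_tsub_cancel_right]
  have : ((k + 1 : ℕ) : ℝ) ≠ 0 := by positivity
  field_simp
  ring

lemma hasDerivAt_Kfun {N : ℝ} (hN : 2 ≤ N) (X : ℝ) :
    HasDerivAt (Kfun N) (-2 * Kfun (N + 2) X) X := by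
  set g' : ℕ → ℝ → ℝ := fun n y => Nat.casesOn n 0 fun k => -2 * Kterm (N + 2) k y with hg'
  set b : ℕ → ℝ := fun n => Nat.casesOn n 0 fun k =>
    2 * (2 ^ ((N+2)/2) / Real.Gamma ((N+2)/2) * ((4 * (|X| + 1)) ^ k / k.factorial)) with hb
  have hbs : Summable b := by
    rw [← summable_nat_add_iff 1]
    exact ((Real.summable_pow_div_factorial _).mul_left _).mul_left _
  have h := hasDerivAt_tsum_of_isPreconnected (g := Kterm N) (g' := g') (y₀ := X) (y := X) hbs
    (Metric.isOpen_ball (x := (0:ℝ)) (ε := |X| + 1)) (convex_ball _ _).isPreconnected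
    (fun n y _ => by
      cases n with
      | zero => exact hasDerivAt_Kterm_zero N y
      | succ k => exact hasDerivAt_Kterm_succ N y k)
    (fun n y hy => by
      have hy : |y| ≤ |X| + 1 := by simpa using (Metric.mem_ball.1 hy).le
      cases n with
      | zero => simp [hg', hb]
      | succ k =>
        simp only [hg', hb, norm_mul, norm_neg, RCLike.norm_ofNat]
        gcongr
        exact abs_Kterm_le (by linarith) hy k)
    (by simp) (summable_Kterm hN X) (by simp)
  refine h.congr_deriv ?_
  rw [Summable.tsum_eq_zero_add]
  · rw [show g' 0 X = 0 from rfl, zero_add]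
    exact tsum_mul_left
  · rw [← summable_nat_add_iff 1]
    exact (summable_Kterm (by linarith) X).mul_left _

lemma continuous_Kfun {N : ℝ} (hN : 2 ≤ N) : Continuous (Kfun N) :=
  continuous_iff_continuousAt.2 fun X => (hasDerivAt_Kfun hN X).continuousAt

/-- The differential equation `X K'' + (N/2) K' + 4 K = 0`, in terms of contiguous functions. -/
lemma Kfun_contiguous {N : ℝ} (hN : 2 ≤ N) (X : ℝ) :
    4 * X * Kfun (N + 4) X - N * Kfun (N + 2) X + 4 * Kfun N X = 0 := by
  have h0 := (summable_Kterm (N := N) (by linarith) X).hasSum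
  have h2 := (summable_Kterm (N := N + 2) (by linarith) X).hasSum
  have h4 := (summable_Kterm (N := N + 4) (by linarith) X).hasSum.mul_left (4 * X)
  set f : ℕ → ℝ := fun n => Nat.casesOn n 0 fun k => 4 * X * Kterm (N + 4) k X with hf
  have h4' : HasSum f (4 * X * ∑' k, Kterm (N + 4) k X) := by
    rw [← hasSum_nat_add_iff' 1]
    simpa [hf] using h4
  have h := (h4'.sub (h2.mul_left N)).add (h0.mul_left 4)
  refine h.unique ?_
  convert hasSum_zero with k
  have e2 : (2:ℝ) ^ ((N + 2) / 2) = 2 ^ (N/2) * 2 := by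
    rw [show (N + 2) / 2 = N/2 + 1 by ring, rpow_add_one (by norm_num)]
  have e4 : (2:ℝ) ^ ((N + 4) / 2) = 2 ^ (N/2) * 4 := by
    rw [show (N + 4) / 2 = N/2 + 1 + 1 by ring, rpow_add_one (by norm_num),
      rpow_add_one (by norm_num)]; ring
  cases k with
  | zero =>
    have hG := Real.Gamma_add_one (s := N/2) (by linarith)
    have h0 : Real.Gamma (N/2) ≠ 0 := (Real.Gamma_pos_of_pos (by linarith)).ne'
    rw [show f 0 = 0 from rfl]
    simp only [Kterm, e2, pow_zero, Nat.factorial_zero, Nat.cast_zero, add_zero, Nat.cast_one]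
    rw [show (N + 2) / 2 = N/2 + 1 by ring, hG]
    field_simp
    ring
  | succ k =>
    have hk : (0:ℝ) ≤ k := k.cast_nonneg
    have hG := Real.Gamma_add_one (s := N/2 + (k + 1)) (by positivity)
    have h0 : Real.Gamma (N/2 + (k + 1)) ≠ 0 := (Real.Gamma_pos_of_pos (by positivity)).ne'
    have hf0 : (k.factorial : ℝ) ≠ 0 := by positivity
    rw [show f (k + 1) = 4 * X * Kterm (N + 4) k X from rfl]
    simp only [Kterm, e2, e4, Nat.factorial_succ]
    push_cast
    rw [show (N + 4) / 2 + (k:ℝ) = N/2 + (k + 1) + 1 by ring,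
      show (N + 2) / 2 + ((k:ℝ) + 1) = N/2 + (k + 1) + 1 by ring, hG]
    field_simp
    ring

lemma abs_Kfun_le {N : ℝ} (hN : 2 ≤ N) {X : ℝ} (hX : 0 ≤ X) : |Kfun N X| ≤ |Kfun N 0| := by
  set E : ℝ → ℝ := fun X => Kfun N X ^ 2 + X * Kfun (N + 2) X ^ 2 with hE
  have hd : ∀ Y, HasDerivAt E (2 * Kfun N Y * (-2 * Kfun (N + 2) Y) +
      (Kfun (N + 2) Y ^ 2 + Y * (2 * Kfun (N + 2) Y * (-2 * Kfun (N + 4) Y)))) Y := by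
    intro Y
    have h2 := hasDerivAt_Kfun (N := N + 2) (by linarith) Y
    rw [show N + 2 + 2 = N + 4 by ring] at h2
    have := ((hasDerivAt_Kfun hN Y).pow 2).add ((hasDerivAt_id Y).mul (h2.pow 2))
    refine this.congr_deriv ?_
    simp
  have hanti : AntitoneOn E (Ici 0) := by
    refine antitoneOn_of_deriv_nonpos (convex_Ici 0)
      (fun Y _ => (hd Y).continuousAt.continuousWithinAt)
      (fun Y _ => (hd Y).differentiableAt.differentiableWithinAt) fun Y _ => ?_
    rw [(hd Y).deriv]
    have := Kfun_contiguous hN Y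
    have h : 2 * Kfun N Y * (-2 * Kfun (N + 2) Y) +
      (Kfun (N + 2) Y ^ 2 + Y * (2 * Kfun (N + 2) Y * (-2 * Kfun (N + 4) Y))) =
      (1 - N) * Kfun (N + 2) Y ^ 2 := by
      linear_combination (-Kfun (N + 2) Y) * this
    rw [h]
    nlinarith [sq_nonneg (Kfun (N + 2) Y)]
  have h := hanti (mem_Ici.2 le_rfl) (mem_Ici.2 hX) hX
  simp only [hE, zero_mul, add_zero] at h
  apply sq_le_sq.1
  nlinarith [mul_nonneg hX (sq_nonneg (Kfun (N + 2) X))]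

lemma ae_abs_Kfun_mul_le {N : ℝ} (hN : 2 ≤ N) {ξ : ℝ} (hξ : 0 ≤ ξ) :
    ∀ᵐ x ∂volume.restrict (Ioi (0:ℝ)), |Kfun N (ξ * x)| ≤ |Kfun N 0| :=
  (ae_restrict_mem measurableSet_Ioi).mono fun _ hx =>
    abs_Kfun_le hN (mul_nonneg hξ (mem_Ioi.1 hx).le)

lemma integrableOn_Kfun_mul {N : ℝ} (hN : 2 ≤ N) {f : ℝ → ℝ} (hf : IntegrableOn f (Ioi 0))
    {ξ : ℝ} (hξ : 0 ≤ ξ) : IntegrableOn (fun x => Kfun N (ξ * x) * f x) (Ioi 0) :=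
  Integrable.bdd_mul hf
    ((continuous_Kfun hN).comp (continuous_const_mul ξ)).aestronglyMeasurable
    (ae_abs_Kfun_mul_le hN hξ)

lemma integrableOn_Ftrans_integrand {N : ℝ} (hN : 2 ≤ N) {v : ℝ → ℝ}
    (hv : IntegrableOn (fun x => v x * x ^ (N/2 - 1)) (Ioi 0)) {ξ : ℝ} (hξ : 0 ≤ ξ) :
    IntegrableOn (fun x => Kfun N (ξ * x) * v x * x ^ (N/2 - 1)) (Ioi 0) := by
  simpa only [mul_assoc] using integrableOn_Kfun_mul hN hv hξ

lemma continuousOn_Ftrans {N : ℝ} (hN : 2 ≤ N) {v : ℝ → ℝ}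
    (hv : IntegrableOn (fun x => v x * x ^ (N/2 - 1)) (Ioi 0)) :
    ContinuousOn (Ftrans N v) (Ici 0) := by
  refine continuousOn_of_dominated
    (bound := fun x => |Kfun N 0| * |v x * x ^ (N/2 - 1)|)
    (fun ξ hξ => (integrableOn_Ftrans_integrand hN hv hξ).aestronglyMeasurable)
    (fun ξ hξ => ?_) (hv.abs.const_mul _) (ae_of_all _ fun x => ?_)
  · filter_upwards [ae_abs_Kfun_mul_le hN hξ] with x hx
    rw [mul_assoc, norm_mul]
    exact mul_le_mul_of_nonneg_right hx (norm_nonneg _)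
  · exact ((((continuous_Kfun hN).comp (continuous_mul_const x)).mul continuous_const).mul
      continuous_const).continuousOn

lemma abs_Ftrans_le {N : ℝ} (hN : 2 ≤ N) {v : ℝ → ℝ}
    (hv : IntegrableOn (fun x => v x * x ^ (N/2 - 1)) (Ioi 0)) {ξ : ℝ} (hξ : 0 ≤ ξ) :
    |Ftrans N v ξ| ≤ ∫ x in Ioi (0:ℝ), |Kfun N 0| * |v x * x ^ (N/2 - 1)| := by
  rw [Ftrans, ← Real.norm_eq_abs]
  refine norm_integral_le_of_norm_le (hv.abs.const_mul _) ?_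
  filter_upwards [ae_abs_Kfun_mul_le hN hξ] with x hx
  rw [mul_assoc, norm_mul]
  exact mul_le_mul_of_nonneg_right hx (norm_nonneg _)

/-- The transform is symmetric with respect to the weight `x ^ (N/2 - 1)`. -/
lemma integral_Ftrans_mul {N : ℝ} (hN : 2 ≤ N) {v w : ℝ → ℝ}
    (hv : IntegrableOn (fun x => v x * x ^ (N/2 - 1)) (Ioi 0))
    (hw : IntegrableOn (fun x => w x * x ^ (N/2 - 1)) (Ioi 0)) :
    ∫ x in Ioi (0:ℝ), Ftrans N v x * (w x * x ^ (N/2 - 1)) =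
      ∫ x in Ioi (0:ℝ), Ftrans N w x * (v x * x ^ (N/2 - 1)) := by
  have hint : Integrable (Function.uncurry fun x y : ℝ =>
      Kfun N (x * y) * v y * y ^ (N/2 - 1) * (w x * x ^ (N/2 - 1)))
      ((volume.restrict (Ioi 0)).prod (volume.restrict (Ioi 0))) := by
    have h := (hw.mul_prod hv).bdd_mul (f := fun z : ℝ × ℝ => Kfun N (z.1 * z.2))
      (c := |Kfun N 0|)
      ((continuous_Kfun hN).comp (continuous_fst.mul continuous_snd)).aestronglyMeasurable (by
        rw [Measure.prod_restrict]
        refine (ae_restrict_mem (measurableSet_Ioi.prod measurableSet_Ioi)).mono fun z hz => ?_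
        exact abs_Kfun_le hN (mul_nonneg (mem_Ioi.1 hz.1).le (mem_Ioi.1 hz.2).le))
    refine h.congr (ae_of_all _ fun z => ?_)
    simp only [Function.uncurry]
    ring
  calc _ = ∫ x in Ioi (0:ℝ), ∫ y in Ioi (0:ℝ),
        Kfun N (x * y) * v y * y ^ (N/2 - 1) * (w x * x ^ (N/2 - 1)) := by
        simp only [integral_mul_const, Ftrans]
    _ = ∫ y in Ioi (0:ℝ), ∫ x in Ioi (0:ℝ),
        Kfun N (x * y) * v y * y ^ (N/2 - 1) * (w x * x ^ (N/2 - 1)) :=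
        integral_integral_swap hint
    _ = _ := by
        refine integral_congr_ae (ae_of_all _ fun y => ?_)
        simp only [Ftrans, ← integral_mul_const]
        refine integral_congr_ae (ae_of_all _ fun x => ?_)
        simp only [mul_comm x y]
        ring

lemma integrableOn_rpow_mul_exp_neg {s a : ℝ} (hs : 0 < s) (ha : 0 < a) :
    IntegrableOn (fun x : ℝ => x ^ (s - 1) * rexp (-(a * x))) (Ioi 0) := by
  simpa using integrableOn_rpow_mul_exp_neg_mul_rpow (p := 1) (s := s - 1) (b := a)
    (by linarith) one_pos ha

lemma integrableOn_exp_neg_mul_rpow {N a : ℝ} (hN : 2 ≤ N) (ha : 0 < a) :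
    IntegrableOn (fun x : ℝ => rexp (-(a * x)) * x ^ (N/2 - 1)) (Ioi 0) := by
  simpa only [mul_comm] using integrableOn_rpow_mul_exp_neg (s := N/2) (by linarith) ha

lemma Ftrans_exp {N a : ℝ} (hN : 2 ≤ N) (ha : 0 < a) (ξ : ℝ) :
    Ftrans N (fun x => rexp (-(a * x))) ξ = (2 / a) ^ (N/2) * rexp (-(4 / a * ξ)) := by
  have hs : 0 < N/2 := by linarith
  set c : ℕ → ℝ := fun k => 2 ^ (N/2) * (-4 * ξ) ^ k / (k.factorial * Real.Gamma (N/2 + k))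
    with hc
  set F : ℕ → ℝ → ℝ := fun k x => c k * (x ^ (N/2 + k - 1) * rexp (-(a * x))) with hF
  have hFint : ∀ k, Integrable (F k) (volume.restrict (Ioi 0)) := fun k =>
    (integrableOn_rpow_mul_exp_neg (by positivity) ha).const_mul _
  have hI : ∀ k : ℕ, ∫ x in Ioi (0:ℝ), x ^ (N/2 + k - 1) * rexp (-(a * x)) =
      (1 / a) ^ (N/2 + k) * Real.Gamma (N/2 + k) := fun k =>
    Real.integral_rpow_mul_exp_neg_mul_Ioi (by positivity) ha
  have hG : ∀ k : ℕ, 0 < Real.Gamma (N/2 + k) := fun k =>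
    Real.Gamma_pos_of_pos (by positivity)
  have hpow : (2 / a) ^ (N/2) = 2 ^ (N/2) * (1 / a) ^ (N/2) := by
    rw [← Real.mul_rpow (by norm_num) (by positivity)]; congr 1; ring
  have hval : ∀ k, c k * ((1 / a) ^ (N/2 + k) * Real.Gamma (N/2 + k)) =
      (2 / a) ^ (N/2) * ((-(4 / a * ξ)) ^ k / k.factorial) := by
    intro k
    have := (hG k).ne'
    have e : (-(4 / a * ξ)) ^ k = (-4 * ξ) ^ k * (1 / a) ^ k := by
      rw [← mul_pow]; congr 1; ring
    rw [hc, hpow, e, Real.rpow_add_natCast (by positivity)]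
    field_simp
  have hnorm : ∀ k, ∫ x in Ioi (0:ℝ), ‖F k x‖ =
      |(2 / a) ^ (N/2) * ((-(4 / a * ξ)) ^ k / k.factorial)| := by
    intro k
    rw [← hval, abs_mul, abs_of_nonneg (mul_nonneg (by positivity) (hG k).le), ← hI,
      ← integral_const_mul]
    refine setIntegral_congr_fun measurableSet_Ioi fun x hx => ?_
    have hx : 0 < x := hx
    simp only [hF, norm_mul, Real.norm_eq_abs, Real.abs_exp]
    rw [abs_of_nonneg (Real.rpow_nonneg hx.le _)]
  have hsum := hasSum_integral_of_summable_integral_norm hFint (by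
    simp only [hnorm]
    exact ((Real.summable_pow_div_factorial _).mul_left _).abs)
  have h1 : ∀ k, ∫ x in Ioi (0:ℝ), F k x =
      (2 / a) ^ (N/2) * ((-(4 / a * ξ)) ^ k / k.factorial) := fun k => by
    rw [← hval, ← hI, ← integral_const_mul]
  simp only [h1] at hsum
  have hexp : HasSum (fun k : ℕ => (-(4 / a * ξ)) ^ k / k.factorial) (rexp (-(4 / a * ξ))) := by
    rw [Real.exp_eq_exp_ℝ]; exact NormedSpace.expSeries_div_hasSum_exp _
  rw [← hsum.unique (hexp.mul_left _)]
  refine setIntegral_congr_fun measurableSet_Ioi fun x hx => ?_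
  have hx : 0 < x := hx
  simp only [Kfun, mul_assoc _ (rexp _), ← tsum_mul_right]
  refine tsum_congr fun k => ?_
  simp only [hF, hc]
  rw [show N/2 + (k:ℝ) - 1 = N/2 - 1 + k by ring, Real.rpow_add_natCast hx.ne']
  ring

/-- The Bessel-type operator `x u'' + (N/2) u'`, of which `x ↦ Kfun N (ξ * x)` is an
eigenfunction with eigenvalue `-4 * ξ`. -/
noncomputable def besselOp (N : ℝ) (u : ℝ → ℝ) (x : ℝ) : ℝ :=
  x * deriv (deriv u) x + N / 2 * deriv u x

lemma ContDiff.deriv_top {u : ℝ → ℝ} (hu : ContDiff ℝ (⊤ : ℕ∞) u) :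
    ContDiff ℝ (⊤ : ℕ∞) (deriv u) :=
  (contDiff_infty_iff_deriv.1 hu).2

lemma ContDiff.besselOp {u : ℝ → ℝ} (hu : ContDiff ℝ (⊤ : ℕ∞) u) (N : ℝ) :
    ContDiff ℝ (⊤ : ℕ∞) (besselOp N u) :=
  (contDiff_id.mul hu.deriv_top.deriv_top).add (contDiff_const.mul hu.deriv_top)

lemma HasCompactSupport.besselOp {u : ℝ → ℝ} (hu : HasCompactSupport u) (N : ℝ) :
    HasCompactSupport (besselOp N u) :=
  (hu.deriv.deriv.mul_left (f := fun x => x)).add (hu.deriv.mul_left (f := fun _ => N / 2))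

lemma integrableOn_mul_rpow_of_hasCompactSupport {N : ℝ} (hN : 2 ≤ N) {u : ℝ → ℝ}
    (hu : Continuous u) (hsupp : HasCompactSupport u) :
    IntegrableOn (fun x => u x * x ^ (N/2 - 1)) (Ioi 0) :=
  ((hu.mul (Real.continuous_rpow_const (by linarith))).integrable_of_hasCompactSupport
    hsupp.mul_right).integrableOn

lemma Ftrans_besselOp {N : ℝ} (hN : 2 ≤ N) {u : ℝ → ℝ} (hu : ContDiff ℝ (⊤ : ℕ∞) u)
    (hsupp : HasCompactSupport u) {ξ : ℝ} (hξ : 0 ≤ ξ) :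
    Ftrans N (besselOp N u) ξ = -4 * ξ * Ftrans N u ξ := by
  set W : ℝ → ℝ := fun x => x ^ (N/2) *
    (-2 * Kfun (N + 2) (ξ * x) * ξ * u x - Kfun N (ξ * x) * deriv u x) with hW
  have hu' := hu.deriv_top
  have hd : ∀ v : ℝ → ℝ, ContDiff ℝ (⊤ : ℕ∞) v → ∀ x, HasDerivAt v (deriv v x) x :=
    fun v hv x => (hv.differentiable (by simp) x).hasDerivAt
  have hK : ∀ M : ℝ, 2 ≤ M → ∀ x, HasDerivAt (fun x => Kfun M (ξ * x))
      (-2 * Kfun (M + 2) (ξ * x) * ξ) x := fun M hM x =>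
    (hasDerivAt_Kfun hM (ξ * x)).comp x (by simpa using (hasDerivAt_id x).const_mul ξ)
  have hcont : Continuous W := by
    have h0 := (continuous_Kfun hN).comp (continuous_const_mul ξ)
    have h2 := (continuous_Kfun (N := N + 2) (by linarith)).comp (continuous_const_mul ξ)
    exact (Real.continuous_rpow_const (by linarith)).mul
      ((((continuous_const.mul h2).mul continuous_const).mul hu.continuous).sub
        (h0.mul hu'.continuous))
  have hWsupp : HasCompactSupport W :=
    ((hsupp.mul_left (f := fun x => -2 * Kfun (N + 2) (ξ * x) * ξ)).sub
      (hsupp.deriv.mul_left (f := fun x => Kfun N (ξ * x)))).mul_left (f := fun x => x ^ (N/2))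
  have hderiv : ∀ x ∈ Ioi (0:ℝ), HasDerivAt W
      (-4 * ξ * (Kfun N (ξ * x) * u x * x ^ (N/2 - 1)) -
        Kfun N (ξ * x) * besselOp N u x * x ^ (N/2 - 1)) x := by
    intro x hx
    have hx : 0 < x := hx
    have h2 := hK (N + 2) (by linarith) x
    rw [show N + 2 + 2 = N + 4 by ring] at h2
    have h := (Real.hasDerivAt_rpow_const (p := N/2) (Or.inl hx.ne')).mul
      ((((h2.const_mul (-2)).mul_const ξ).mul (hd u hu x)).sub
        ((hK N hN x).mul (hd _ hu' x)))
    refine h.congr_deriv ?_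
    have e : x ^ (N/2) = x ^ (N/2 - 1) * x := by
      rw [← Real.rpow_add_one hx.ne']; congr 1; ring
    simp only [Pi.mul_apply, Pi.sub_apply, besselOp]
    rw [e]
    linear_combination (x ^ (N/2 - 1) * u x * ξ) * Kfun_contiguous hN (ξ * x)
  have hi1 := (integrableOn_Ftrans_integrand hN
    (integrableOn_mul_rpow_of_hasCompactSupport hN hu.continuous hsupp) hξ).const_mul (-4 * ξ)
  have hi2 := integrableOn_Ftrans_integrand hN (integrableOn_mul_rpow_of_hasCompactSupport hN
    (hu.besselOp N).continuous (hsupp.besselOp N)) hξ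
  have h := integral_Ioi_of_hasDerivAt_of_tendsto (m := 0) hcont.continuousWithinAt hderiv
    (hi1.sub hi2) (hWsupp.is_zero_at_infty.mono_left atTop_le_cocompact)
  rw [integral_sub hi1 hi2, integral_const_mul] at h
  have hW0 : W 0 = 0 := by
    simp [hW, Real.zero_rpow (by linarith : N/2 ≠ 0)]
  rw [hW0] at h
  simp only [Ftrans]
  linarith

lemma exists_pow_mul_abs_Ftrans_le {N : ℝ} (hN : 2 ≤ N) (n : ℕ) {u : ℝ → ℝ}
    (hu : ContDiff ℝ (⊤ : ℕ∞) u) (hsupp : HasCompactSupport u) :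
    ∃ C, ∀ ξ, 0 ≤ ξ → ξ ^ n * |Ftrans N u ξ| ≤ C := by
  induction n generalizing u with
  | zero =>
    exact ⟨_, fun ξ hξ => by
      simpa using abs_Ftrans_le hN
        (integrableOn_mul_rpow_of_hasCompactSupport hN hu.continuous hsupp) hξ⟩
  | succ n ih =>
    obtain ⟨C, hC⟩ := ih (hu.besselOp N) (hsupp.besselOp N)
    refine ⟨C / 4, fun ξ hξ => ?_⟩
    have h := hC ξ hξ
    rw [Ftrans_besselOp hN hu hsupp hξ, abs_mul, abs_mul, abs_of_nonneg hξ] at h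
    norm_num at h
    rw [pow_succ]
    linarith

lemma integrableOn_Ftrans_mul_rpow {N : ℝ} (hN : 2 ≤ N) {u : ℝ → ℝ}
    (hu : ContDiff ℝ (⊤ : ℕ∞) u) (hsupp : HasCompactSupport u) :
    IntegrableOn (fun ξ => Ftrans N u ξ * ξ ^ (N/2 - 1)) (Ioi 0) := by
  have hcont : ContinuousOn (fun ξ => Ftrans N u ξ * ξ ^ (N/2 - 1)) (Ici 0) :=
    (continuousOn_Ftrans hN
      (integrableOn_mul_rpow_of_hasCompactSupport hN hu.continuous hsupp)).mul
      (Real.continuous_rpow_const (by linarith)).continuousOn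
  obtain ⟨n, hn⟩ := exists_nat_gt (N/2)
  obtain ⟨C, hC⟩ := exists_pow_mul_abs_Ftrans_le hN n hu hsupp
  rw [← Ioc_union_Ioi_eq_Ioi zero_le_one]
  refine IntegrableOn.union ?_ ?_
  · exact ((hcont.mono Icc_subset_Ici_self).integrableOn_Icc).mono_set Ioc_subset_Icc_self
  · refine Integrable.mono'
      ((integrableOn_Ioi_rpow_of_lt (a := N/2 - 1 - n) (by linarith) one_pos).const_mul C)
      ((hcont.mono (Ioi_subset_Ici zero_le_one)).aestronglyMeasurable measurableSet_Ioi) ?_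
    filter_upwards [ae_restrict_mem measurableSet_Ioi] with ξ hξ
    have hξ : 0 < ξ := zero_lt_one.trans hξ
    rw [Real.rpow_sub_natCast hξ.ne', norm_mul, Real.norm_eq_abs, Real.norm_eq_abs,
      abs_of_nonneg (Real.rpow_nonneg hξ.le _), mul_div_assoc', le_div_iff₀ (by positivity)]
    have := mul_le_mul_of_nonneg_right (hC ξ hξ.le) (Real.rpow_nonneg hξ.le (N/2 - 1))
    linarith

/-- Uniqueness for the Laplace transform. -/
lemma eqOn_zero_of_integral_exp_neg_eq_zero {h : ℝ → ℝ} (hcont : ContinuousOn h (Ici 0))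
    (h0 : h 0 = 0) (hlim : Filter.Tendsto h Filter.atTop (nhds 0)) (hint : IntegrableOn h (Ioi 0))
    (hlap : ∀ k : ℕ, ∫ x in Ioi (0:ℝ), h x * rexp (-(k * x)) = 0) : EqOn h 0 (Ioi 0) := by
  obtain ⟨M, hM⟩ : ∃ M, ∀ x ∈ Ioi (0:ℝ), |h x| ≤ M := by
    obtain ⟨R, hR⟩ := Filter.eventually_atTop.1
      (hlim.abs.eventually (gt_mem_nhds (show |(0:ℝ)| < 1 by simp)))
    obtain ⟨M, hM⟩ := isCompact_Icc.exists_bound_of_continuousOn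
      (hcont.mono (show Icc 0 R ⊆ Ici 0 from Icc_subset_Ici_self))
    refine ⟨max M 1, fun x hx => ?_⟩
    rcases le_total x R with hxR | hxR
    · exact (hM x ⟨le_of_lt hx, hxR⟩).trans (le_max_left _ _)
    · exact (hR x hxR).le.trans (le_max_right _ _)
  have hmeas : AEStronglyMeasurable h (volume.restrict (Ioi 0)) := hint.aestronglyMeasurable
  have hsq : IntegrableOn (fun x => h x * h x) (Ioi 0) :=
    Integrable.bdd_mul hint hmeas ((ae_restrict_mem measurableSet_Ioi).mono hM)
  have hg : ContinuousOn (fun t => h (-Real.log t)) (Icc 0 1) := by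
    intro t ht
    rcases ht.1.eq_or_lt with rfl | ht0
    · have hlog : Filter.Tendsto (fun t => h (-Real.log t)) (nhdsWithin 0 (Ioi 0)) (nhds 0) :=
        hlim.comp (Filter.tendsto_neg_atBot_atTop.comp Real.tendsto_log_nhdsGT_zero)
      have hc : ContinuousWithinAt (fun t => h (-Real.log t)) (Ioi 0) 0 := by
        simpa [ContinuousWithinAt, h0] using hlog
      refine (continuousWithinAt_insert_self.2 hc).mono ?_
      rw [Ioi_insert]
      exact Icc_subset_Ici_self
    · have hl : ∀ s ∈ Icc (0:ℝ) 1, -Real.log s ∈ Ici (0:ℝ) := fun s hs => by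
        simpa using Real.log_nonpos hs.1 hs.2
      exact (hcont _ (hl t ht)).comp (f := fun t => -Real.log t)
        (Real.continuousAt_log ht0.ne').neg.continuousWithinAt hl
  have hpoly : ∀ p : Polynomial ℝ,
      IntegrableOn (fun x => h x * p.eval (rexp (-x))) (Ioi 0) ∧
        ∫ x in Ioi (0:ℝ), h x * p.eval (rexp (-x)) = 0 := by
    intro p
    have hi : ∀ k : ℕ, IntegrableOn (fun x => h x * rexp (-(k * x))) (Ioi 0) := fun k => by
      simp only [mul_comm (h _)]
      refine Integrable.bdd_mul (c := 1) hint (by fun_prop) ?_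
      filter_upwards [ae_restrict_mem measurableSet_Ioi] with x hx
      have hx : 0 < x := hx
      rw [Real.norm_eq_abs, Real.abs_exp, Real.exp_le_one_iff, neg_nonpos]
      positivity
    have e : (fun x => h x * p.eval (rexp (-x))) = fun x =>
        ∑ k ∈ Finset.range (p.natDegree + 1), p.coeff k * (h x * rexp (-(k * x))) := by
      ext x
      rw [Polynomial.eval_eq_sum_range, Finset.mul_sum]
      refine Finset.sum_congr rfl fun k _ => ?_
      rw [← Real.exp_nat_mul, mul_neg]
      ring
    rw [e]
    refine ⟨integrable_finsetSum _ fun k _ => (hi k).const_mul _, ?_⟩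
    rw [integral_finsetSum _ fun k _ => (hi k).const_mul _]
    simp [integral_const_mul, hlap]
  have hzero : ∫ x in Ioi (0:ℝ), h x * h x = 0 := by
    have hle : ∀ ε > 0, ∫ x in Ioi (0:ℝ), h x * h x ≤ ε * ∫ x in Ioi (0:ℝ), |h x| := by
      intro ε hε
      obtain ⟨p, hp⟩ := exists_polynomial_near_of_continuousOn 0 1 _ hg ε hε
      obtain ⟨hp1, hp2⟩ := hpoly p
      have e := integral_sub hsq hp1
      rw [hp2, sub_zero] at e
      rw [← e, ← integral_const_mul]
      refine setIntegral_mono_on (hsq.sub hp1) (hint.abs.const_mul _) measurableSet_Ioi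
        fun x hx => ?_
      have hx : 0 < x := hx
      have := hp (rexp (-x)) ⟨(Real.exp_pos _).le, by simpa using hx.le⟩
      rw [Real.log_exp, neg_neg] at this
      calc h x * h x - h x * p.eval (rexp (-x)) ≤ |h x * (h x - p.eval (rexp (-x)))| := by
            rw [← mul_sub]; exact le_abs_self _
        _ = |p.eval (rexp (-x)) - h x| * |h x| := by rw [abs_mul, abs_sub_comm, mul_comm]
        _ ≤ ε * |h x| := by gcongr
    refine le_antisymm ?_ (integral_nonneg fun x => mul_self_nonneg _)
    have hI : 0 ≤ ∫ x in Ioi (0:ℝ), |h x| := integral_nonneg fun x => abs_nonneg _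
    refine le_of_forall_pos_le_add fun δ hδ => ?_
    refine (hle (δ / ((∫ x in Ioi (0:ℝ), |h x|) + 1)) (by positivity)).trans ?_
    rw [zero_add, div_mul_eq_mul_div, div_le_iff₀ (by positivity)]
    nlinarith
  rw [setIntegral_eq_zero_iff_of_nonneg_ae (ae_of_all _ fun x => mul_self_nonneg _) hsq] at hzero
  refine Measure.eqOn_open_of_ae_eq (μ := volume) (hzero.mono fun x hx => ?_) isOpen_Ioi
    (hcont.mono Ioi_subset_Ici_self) continuousOn_const
  simpa using hx

/-- (Statement 10: inversion formula.)  For smooth compactly supported `u`, the integrand of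
`F(Fu)` is integrable on `(0,∞)` and `F(Fu)(x) = u(x)` for every `x ≥ 0`: `F` is its own
inverse. -/
theorem Ftrans_self_inverse (N : ℝ) (hN : 4 < N)
    (u : ℝ → ℝ) (hu : ContDiff ℝ (⊤ : ℕ∞) u) (hsupp : HasCompactSupport u) :
    ∀ x : ℝ, 0 ≤ x →
      IntegrableOn (fun ξ => Kfun N (x * ξ) * Ftrans N u ξ * ξ ^ (N/2 - 1)) (Ioi 0) ∧
      Ftrans N (Ftrans N u) x = u x := by
  have hN2 : 2 ≤ N := by linarith
  have hui := integrableOn_mul_rpow_of_hasCompactSupport hN2 hu.continuous hsupp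
  have hFi := integrableOn_Ftrans_mul_rpow hN2 hu hsupp
  have hFF := continuousOn_Ftrans hN2 hFi
  have key : ∀ a : ℝ, 0 < a →
      ∫ x in Ioi (0:ℝ), Ftrans N (Ftrans N u) x * (rexp (-(a * x)) * x ^ (N/2 - 1)) =
      ∫ x in Ioi (0:ℝ), u x * (rexp (-(a * x)) * x ^ (N/2 - 1)) := by
    intro a ha
    have h4a : 0 < 4 / a := by positivity
    rw [integral_Ftrans_mul hN2 hFi (integrableOn_exp_neg_mul_rpow hN2 ha)]
    calc _ = (2 / a) ^ (N/2) * ∫ x in Ioi (0:ℝ),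
          Ftrans N u x * (rexp (-(4 / a * x)) * x ^ (N/2 - 1)) := by
          rw [← integral_const_mul]
          congr 1 with x
          rw [Ftrans_exp hN2 ha]
          ring
      _ = ∫ x in Ioi (0:ℝ), u x * (rexp (-(a * x)) * x ^ (N/2 - 1)) := by
          rw [integral_Ftrans_mul hN2 hui (integrableOn_exp_neg_mul_rpow hN2 h4a),
            ← integral_const_mul]
          congr 1 with x
          have e : (2 / a) ^ (N/2) * (2 / (4 / a)) ^ (N/2) = 1 := by
            rw [← Real.mul_rpow (by positivity) (by positivity),
              show 2 / a * (2 / (4 / a)) = 1 by field_simp; norm_num, Real.one_rpow]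
          rw [Ftrans_exp hN2 h4a, show 4 / (4 / a) = a by field_simp]
          linear_combination (rexp (-(a * x)) * u x * x ^ (N/2 - 1)) * e
  set h : ℝ → ℝ := fun x =>
    (Ftrans N (Ftrans N u) x - u x) * (rexp (-(1 * x)) * x ^ (N/2 - 1)) with hh
  have hDcont : ContinuousOn (fun x => Ftrans N (Ftrans N u) x - u x) (Ici 0) :=
    hFF.sub hu.continuous.continuousOn
  obtain ⟨M, hM⟩ : ∃ M, ∀ x, 0 ≤ x → |Ftrans N (Ftrans N u) x - u x| ≤ M := by
    obtain ⟨C, hC⟩ := hsupp.exists_bound_of_continuous hu.continuous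
    exact ⟨_, fun x hx => (abs_sub _ _).trans (add_le_add (abs_Ftrans_le hN2 hFi hx) (hC x))⟩
  have hbdd : ∀ v : ℝ → ℝ, ContinuousOn v (Ici 0) → (∃ M, ∀ x, 0 ≤ x → |v x| ≤ M) →
      ∀ a : ℝ, 0 < a →
      IntegrableOn (fun x => v x * (rexp (-(a * x)) * x ^ (N/2 - 1))) (Ioi 0) := by
    rintro v hv ⟨M, hM⟩ a ha
    exact Integrable.bdd_mul (integrableOn_exp_neg_mul_rpow hN2 ha)
      ((hv.mono Ioi_subset_Ici_self).aestronglyMeasurable measurableSet_Ioi)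
      ((ae_restrict_mem measurableSet_Ioi).mono fun x hx => hM x (le_of_lt hx))
  have hwcont : Continuous fun x : ℝ => rexp (-(1 * x)) * x ^ (N/2 - 1) :=
    (by fun_prop : Continuous fun x : ℝ => rexp (-(1 * x))).mul
      (Real.continuous_rpow_const (by linarith))
  have hlim : Filter.Tendsto h Filter.atTop (nhds 0) := by
    have hw := (tendsto_rpow_mul_exp_neg_mul_atTop_nhds_zero (N/2 - 1) 1 one_pos).const_mul M
    rw [mul_zero] at hw
    refine squeeze_zero_norm' ?_ hw
    filter_upwards [Filter.eventually_ge_atTop 0] with x hx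
    rw [hh, norm_mul, Real.norm_eq_abs, Real.norm_eq_abs, neg_mul, mul_comm (x ^ _),
      abs_of_nonneg (mul_nonneg (Real.exp_pos _).le (Real.rpow_nonneg hx _))]
    exact mul_le_mul_of_nonneg_right (hM x hx)
      (mul_nonneg (Real.exp_pos _).le (Real.rpow_nonneg hx _))
  have hzero := eqOn_zero_of_integral_exp_neg_eq_zero (h := h)
    (hDcont.mul hwcont.continuousOn)
    (by simp [hh, Real.zero_rpow (by linarith : N/2 - 1 ≠ 0)]) hlim
    (hbdd _ hDcont ⟨M, hM⟩ 1 one_pos) (fun k => by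
      have hk : (0:ℝ) < k + 1 := by positivity
      have hi1 := hbdd _ hFF ⟨_, fun x hx => abs_Ftrans_le hN2 hFi hx⟩ _ hk
      have hi2 := hbdd _ hu.continuous.continuousOn
        ((hsupp.exists_bound_of_continuous hu.continuous).imp fun C hC x _ => hC x) _ hk
      refine Eq.trans ?_ ((integral_sub hi1 hi2).trans (sub_eq_zero.2 (key (k + 1) hk)))
      congr 1 with x
      simp only [hh]
      rw [show -((k + 1 : ℝ) * x) = -(1 * x) + -(k * x) by ring, Real.exp_add]
      ring)
  have hpos : EqOn (Ftrans N (Ftrans N u)) u (Ioi 0) := by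
    intro x hx
    have hx' : 0 < x := hx
    have := hzero hx
    simp only [hh, Pi.zero_apply, mul_eq_zero, Real.exp_ne_zero,
      (Real.rpow_pos_of_pos hx' _).ne', or_false] at this
    linarith
  have hall : EqOn (Ftrans N (Ftrans N u)) u (Ici 0) :=
    hpos.of_subset_closure hFF hu.continuous.continuousOn Ioi_subset_Ici_self
      (by rw [closure_Ioi])
  exact fun x hx => ⟨integrableOn_Ftrans_integrand hN2 hFi hx, hall hx⟩
end

section
/- (Proposition 7, concrete form.) There exist a strictly increasing sequence of real numbers λ₁ < λ₂ < ⋯ < λₙ < λ_{n+1} < ⋯ with λₙ → +∞, and functions φₙ ∈ C^∞((−π/2, π/2)) ∩ L²(−π/2, π/2), such that: (i) −φₙ'' + q·φₙ = λₙ·φₙ on (−π/2, π/2) for every n; (ii) (φₙ)_{n≥1} is an orthonormal Hilbert basis of L²(−π/2, π/2); (iii) each φₙ has finite energy, ∫_{−π/2}^{π/2} ( |φₙ'(ξ)|² + q(ξ)|φₙ(ξ)|² ) dξ < ∞; and (iv) every eigenvalue is simple: for any λ ∈ ℝ, every twice continuously differentiable η ∈ L²(−π/2, π/2) with finite energy ∫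 ( |η'|² + q|η|² ) < ∞ satisfying −η'' + qη = λη on (−π/2, π/2) is a scalar multiple of φₙ for some n with λ = λₙ, or is identically zero. -/
open Set Real MeasureTheory Filter

/-- `M(x) = exp(∫₀ˣ ℓ₁)`. -/
noncomputable def Mfun (ℓ₁ : ℝ → ℝ) (x : ℝ) : ℝ := Real.exp (∫ x' in (0:ℝ)..x, ℓ₁ x')

/-- `a(x) = x^{5/2}(1−x)^{N/2}·M(x)`. -/
noncomputable def afun (N : ℝ) (ℓ₁ : ℝ → ℝ) (x : ℝ) : ℝ :=
  x ^ ((5:ℝ)/2) * (1 - x) ^ (N/2) * Mfun ℓ₁ x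

/-- `b(x) = x^{3/2}(1−x)^{N/2−1}·M(x)`. -/
noncomputable def bfun (N : ℝ) (ℓ₁ : ℝ → ℝ) (x : ℝ) : ℝ :=
  x ^ ((3:ℝ)/2) * (1 - x) ^ (N/2 - 1) * Mfun ℓ₁ x

/-- `R = a'/a + b'/b`. -/
noncomputable def Rfun (N : ℝ) (ℓ₁ : ℝ → ℝ) (x : ℝ) : ℝ :=
  deriv (afun N ℓ₁) x / afun N ℓ₁ x + deriv (bfun N ℓ₁) x / bfun N ℓ₁ x

/-- The Liouville potential (in the `x` variable):
`Q = L₀ + (1/4)(a/b)[R' − (1/4)R² + (a'/a)·R]` with `R = a'/a + b'/b`. -/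
noncomputable def Qfun (N : ℝ) (ℓ₁ L₀ : ℝ → ℝ) (x : ℝ) : ℝ :=
  L₀ x + (1/4) * (afun N ℓ₁ x / bfun N ℓ₁ x) *
    (deriv (Rfun N ℓ₁) x - (1/4) * (Rfun N ℓ₁ x) ^ 2
      + (deriv (afun N ℓ₁) x / afun N ℓ₁ x) * Rfun N ℓ₁ x)

/-- The Liouville potential in the variable `ξ = arcsin(2x−1)`, i.e. `x = (1+sin ξ)/2`. -/
noncomputable def qfun (N : ℝ) (ℓ₁ L₀ : ℝ → ℝ) (ξ : ℝ) : ℝ :=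
  Qfun N ℓ₁ L₀ ((1 + Real.sin ξ)/2)

theorem exists_strictMono_range_eq {S : Set ℝ} (hS : S.Infinite)
    (hfin : ∀ R : ℝ, (S ∩ Iic R).Finite) :
    ∃ κ : ℕ → ℝ, StrictMono κ ∧ Tendsto κ atTop atTop ∧ range κ = S := by
  classical
  have hIcc : ∀ a b : S, (Icc a b).Finite := fun a b => by
    refine Set.Finite.of_finite_image (f := Subtype.val) ?_ Subtype.val_injective.injOn
    refine (hfin b).subset ?_
    rintro _ ⟨x, hx, rfl⟩
    exact ⟨x.2, hx.2⟩
  let : LocallyFiniteOrder S := LocallyFiniteOrder.ofFiniteIcc hIcc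
  let := LinearLocallyFiniteOrder.succOrder S
  let := LinearLocallyFiniteOrder.predOrder S
  obtain ⟨s₀, hs₀⟩ := hS.nonempty
  obtain ⟨m, ⟨hmS, hm⟩, hmin⟩ := (S ∩ Iic s₀).exists_min_image id (hfin s₀) ⟨s₀, hs₀, self_mem_Iic⟩
  let : OrderBot S :=
    { bot := ⟨m, hmS⟩
      bot_le := fun x => by
        rcases le_total (x : ℝ) s₀ with h | h
        · exact hmin x ⟨x.2, h⟩
        · exact le_trans (b := s₀) hm h }
  have : NoMaxOrder S := ⟨fun x => by
    by_contra! h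
    exact hS ((hfin x).subset fun y hy => ⟨hy, h ⟨y, hy⟩⟩)⟩
  let e : S ≃o ℕ := orderIsoNatOfLinearSuccPredArch
  have hmono : StrictMono fun n => (e.symm n : ℝ) := fun i j hij => e.symm.strictMono hij
  have hrange : range (fun n => (e.symm n : ℝ)) = S := by
    ext x
    constructor
    · rintro ⟨n, rfl⟩; exact (e.symm n).2
    · intro hx; exact ⟨e ⟨x, hx⟩, by simp⟩
  refine ⟨_, hmono, ?_, hrange⟩
  refine tendsto_atTop_atTop_of_monotone hmono.monotone fun R => ?_
  by_contra! h
  refine hS ((hfin R).subset fun x hx => ⟨hx, ?_⟩)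
  obtain ⟨n, rfl⟩ := hrange.symm ▸ hx
  exact (h n).le

open RealInnerProductSpace in
theorem exists_eigenbasis_of_compact {H : Type*} [NormedAddCommGroup H] [InnerProductSpace ℝ H]
    [CompleteSpace H] (hH : ¬ FiniteDimensional ℝ H) (T : H →L[ℝ] H)
    (hc : IsCompactOperator T) (hsymm : T.IsSymmetric) (hpos : ∀ x ≠ 0, 0 < ⟪T x, x⟫)
    (hsimple : ∀ (μ : ℝ) (x y : H), x ≠ 0 → μ • T x = x → μ • T y = y → ∃ c : ℝ, y = c • x) :
    ∃ (κ : ℕ → ℝ) (e : ℕ → H), StrictMono κ ∧ Tendsto κ atTop atTop ∧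
      (∀ n, κ n • T (e n) = e n) ∧ Orthonormal ℝ e ∧ (∀ x, (∀ n, ⟪x, e n⟫ = 0) → x = 0) ∧
      ∀ (μ : ℝ) (x : H), x ≠ 0 → μ • T x = x → ∃ n, ∃ c : ℝ, μ = κ n ∧ x = c • e n := by
  classical
  set S : Set ℝ := {κ | ∃ x : H, ‖x‖ = 1 ∧ κ • T x = x} with hSdef
  have hpos' : ∀ (κ : ℝ) (x : H), x ≠ 0 → κ • T x = x → 0 < κ := by
    intro κ x hx h
    have h1 := hpos x hx
    have h2 : κ * ⟪T x, x⟫ = ⟪x, x⟫ := by rw [← real_inner_smul_left, h]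
    have h3 : 0 < ⟪x, x⟫ := real_inner_self_pos.2 hx
    rw [← h2] at h3
    exact pos_of_mul_pos_left h3 h1.le
  have hmemS : ∀ (κ : ℝ) (x : H), x ≠ 0 → κ • T x = x → κ ∈ S := by
    intro κ x hx h
    refine ⟨‖x‖⁻¹ • x, by simp [norm_smul, hx], ?_⟩
    rw [map_smul, smul_comm, h]
  choose! v hv1 hv2 using (fun κ (hκ : κ ∈ S) => hκ)
  have hv0 : ∀ κ ∈ S, v κ ≠ 0 := fun κ hκ h => by simpa [h] using hv1 κ hκ
  have hTv : ∀ κ ∈ S, T (v κ) = κ⁻¹ • v κ := fun κ hκ => by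
    have h0 := (hpos' κ _ (hv0 κ hκ) (hv2 κ hκ)).ne'
    conv_rhs => rw [← hv2 κ hκ]
    rw [smul_smul, inv_mul_cancel₀ h0, one_smul]
  have hkpos : ∀ κ ∈ S, 0 < κ := fun κ hκ => hpos' κ _ (hv0 κ hκ) (hv2 κ hκ)
  have horth : ∀ κ ∈ S, ∀ κ' ∈ S, κ ≠ κ' → ⟪v κ, v κ'⟫ = 0 := by
    intro κ hκ κ' hκ' hne
    have h : ⟪T (v κ), v κ'⟫ = ⟪v κ, T (v κ')⟫ := hsymm _ _
    rw [hTv κ hκ, hTv κ' hκ', real_inner_smul_left, real_inner_smul_right] at h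
    have h' : κ⁻¹ - κ'⁻¹ ≠ 0 := sub_ne_zero.2 fun hh => hne (inv_injective hh)
    have : (κ⁻¹ - κ'⁻¹) * ⟪v κ, v κ'⟫ = 0 := by linarith
    exact (mul_eq_zero.1 this).resolve_left h'
  have hfin : ∀ R : ℝ, (S ∩ Iic R).Finite := by
    intro R
    by_contra hinf
    obtain ⟨K, hK, hsub⟩ := hc.image_closedBall_subset_compact (r := 1)
    let f := Set.Infinite.natEmbedding _ hinf
    have hfS : ∀ n, ((f n : ℝ)) ∈ S := fun n => (f n).2.1
    obtain ⟨y, hy, φ, hφ, hlim⟩ := hK.tendsto_subseq (x := fun n => T (v (f n))) (fun n =>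
      hsub ⟨v (f n), by simp [hv1 _ (hfS n)], rfl⟩)
    have hcau := hlim.cauchySeq
    have hR : 0 < R := (hkpos _ (hfS 0)).trans_le (f 0).2.2
    obtain ⟨n, hn⟩ := Metric.cauchySeq_iff'.1 hcau R⁻¹ (inv_pos.2 hR)
    have h1 := hn (n+1) (by simp)
    set k := (f (φ (n+1)) : ℝ) with hk
    set l := (f (φ n) : ℝ) with hl
    have hkl : k ≠ l := by
      intro h
      have := hφ.injective (f.injective (Subtype.ext h))
      omega
    have hkS : k ∈ S := hfS _
    have hlS : l ∈ S := hfS _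
    have hkR : R⁻¹ ≤ k⁻¹ := inv_anti₀ (hkpos _ hkS) (f (φ (n+1))).2.2
    simp only [Function.comp] at h1
    rw [dist_eq_norm, hTv k hkS, hTv l hlS] at h1
    have h2 : ‖k⁻¹ • v k - l⁻¹ • v l‖ ^ 2 = (k⁻¹) ^ 2 + (l⁻¹) ^ 2 := by
      rw [norm_sub_sq_real, real_inner_smul_left, real_inner_smul_right, horth k hkS l hlS hkl,
        norm_smul, norm_smul, hv1 k hkS, hv1 l hlS]
      simp
    have h3 : (R⁻¹) ^ 2 ≤ (k⁻¹) ^ 2 := by gcongr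
    have h4 : ‖k⁻¹ • v k - l⁻¹ • v l‖ ^ 2 < R⁻¹ ^ 2 := by gcongr
    nlinarith [sq_nonneg (l⁻¹)]
  have hcomplete : ∀ x, (∀ κ ∈ S, ⟪x, v κ⟫ = 0) → x = 0 := by
    intro x hx
    have := ContinuousLinearMap.orthogonalComplement_iSup_eigenspaces_eq_bot hc hsymm
    rw [← Submodule.mem_bot ℝ, ← this, Submodule.mem_orthogonal]
    intro u hu
    induction hu using Submodule.iSup_induction' with
    | mem μ y hy =>
      rw [Module.End.mem_eigenspace_iff] at hy
      by_cases hy0 : y = 0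
      · simp [hy0]
      have hμ : μ ≠ 0 := by
        rintro rfl
        have := hpos y hy0
        simp only [ContinuousLinearMap.coe_coe, zero_smul] at hy
        simp [hy] at this
      have hy' : μ⁻¹ • T y = y := by
        have : T y = μ • y := hy
        rw [this, smul_smul, inv_mul_cancel₀ hμ, one_smul]
      have hS' := hmemS _ _ hy0 hy'
      obtain ⟨c, rfl⟩ := hsimple _ _ y (hv0 _ hS') (hv2 _ hS') hy'
      rw [real_inner_smul_left, real_inner_comm, hx _ hS', mul_zero]
    | zero => simp
    | add y z _ _ hy hz => rw [inner_add_left, hy, hz, add_zero]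
  have hSinf : S.Infinite := by
    intro hSf
    apply hH
    have hspan : (Submodule.span ℝ (v '' S))ᗮ = ⊥ := by
      rw [eq_bot_iff]
      intro x hx
      rw [Submodule.mem_orthogonal'] at hx
      exact hcomplete x fun κ hκ => hx _ (Submodule.subset_span ⟨κ, hκ, rfl⟩)
    have : FiniteDimensional ℝ (Submodule.span ℝ (v '' S)) :=
      FiniteDimensional.span_of_finite ℝ (hSf.image v)
    rw [Submodule.orthogonal_eq_bot_iff] at hspan
    rw [hspan] at this
    exact Module.finite_def.2 (Submodule.fg_top _ |>.1 (Module.finite_def.1 this))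
  obtain ⟨κ, hmono, htend, hrange⟩ := exists_strictMono_range_eq hSinf hfin
  have hκS : ∀ n, κ n ∈ S := fun n => hrange ▸ mem_range_self n
  refine ⟨κ, fun n => v (κ n), hmono, htend, fun n => hv2 _ (hκS n), ⟨fun n => hv1 _ (hκS n),
    fun i j hij => horth _ (hκS i) _ (hκS j) (hmono.injective.ne hij)⟩, ?_, ?_⟩
  · intro x hx
    refine hcomplete x fun k hk => ?_
    obtain ⟨n, rfl⟩ := hrange.symm ▸ hk
    exact hx n
  · intro μ x hx h
    obtain ⟨n, hn⟩ : μ ∈ range κ := hrange.symm ▸ hmemS μ x hx h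
    obtain ⟨c, hc⟩ := hsimple μ (v (κ n)) x (hv0 _ (hκS n)) (hn ▸ hv2 _ (hκS n)) h
    exact ⟨n, c, hn.symm, hc⟩

open RealInnerProductSpace in
theorem exists_resolvent_of_factorization {H : Type*} [NormedAddCommGroup H]
    [InnerProductSpace ℝ H] [CompleteSpace H] (K W : H →L[ℝ] H) (hK : IsCompactOperator K)
    (hKinj : ∀ x, K.adjoint x = 0 → x = 0) (hW : W.IsSymmetric) (hWpos : ∀ x, 0 ≤ ⟪W x, x⟫) :
    ∃ T : H →L[ℝ] H, IsCompactOperator T ∧ T.IsSymmetric ∧ (∀ x ≠ 0, 0 < ⟪T x, x⟫) ∧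
      ∀ (μ : ℝ) (x : H), μ • T x = x ↔ x = K (K.adjoint (μ • x - W x)) := by
  set A : H →L[ℝ] H := ContinuousLinearMap.id ℝ H + K.adjoint ∘L W ∘L K with hA
  have hAapp : ∀ x, A x = x + K.adjoint (W (K x)) := fun x => rfl
  have hAA : ∀ x y, ⟪A x, y⟫ = ⟪x, y⟫ + ⟪W (K x), K y⟫ := fun x y => by
    rw [hAapp, inner_add_left, ContinuousLinearMap.adjoint_inner_left]
  have hAsymm : ∀ x y, ⟪A x, y⟫ = ⟪x, A y⟫ := fun x y => by
    have h : ⟪W (K x), K y⟫ = ⟪K x, W (K y)⟫ := hW _ _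
    rw [hAA, real_inner_comm (A y) x, hAA, h, real_inner_comm (K x), real_inner_comm x y]
  have hcoer : IsCoercive (innerSL ℝ ∘L A) := by
    refine ⟨1, one_pos, fun x => ?_⟩
    have : (innerSL ℝ ∘L A) x x = ⟪x, x⟫ + ⟪W (K x), K x⟫ := hAA x x
    rw [this, real_inner_self_eq_norm_mul_norm]
    linarith [hWpos (K x)]
  set E := hcoer.continuousLinearEquivOfBilin
  have hE : ∀ x, E x = A x := fun x => by
    symm
    exact hcoer.unique_continuousLinearEquivOfBilin fun w => rfl
  have hAE : ∀ x, A (E.symm x) = x := fun x => by rw [← hE]; simp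
  refine ⟨K ∘L (E.symm : H →L[ℝ] H) ∘L K.adjoint, hK.comp_clm _, ?_, ?_, ?_⟩
  · intro x y
    change ⟪K (E.symm (K.adjoint x)), y⟫ = ⟪x, K (E.symm (K.adjoint y))⟫
    rw [← ContinuousLinearMap.adjoint_inner_right, ← ContinuousLinearMap.adjoint_inner_left K]
    conv_lhs => rw [← hAE (K.adjoint y)]
    rw [← hAsymm, hAE]
  · intro x hx
    change 0 < ⟪K (E.symm (K.adjoint x)), x⟫
    rw [← ContinuousLinearMap.adjoint_inner_right]
    have h0 : E.symm (K.adjoint x) ≠ 0 := fun h => hx (hKinj x (by simpa using h))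
    have h1 := hAA (E.symm (K.adjoint x)) (E.symm (K.adjoint x))
    rw [hAsymm, hAE] at h1
    rw [h1]
    linarith [hWpos (K (E.symm (K.adjoint x))), real_inner_self_pos.2 h0]
  · intro μ x
    change μ • K (E.symm (K.adjoint x)) = x ↔ _
    constructor
    · intro h
      set y := E.symm (μ • K.adjoint x) with hy
      have hKy : K y = x := by rw [hy, map_smul, map_smul, h]
      have : A y = μ • K.adjoint x := hAE _
      rw [hAapp, hKy] at this
      rw [map_sub, map_smul, ← this, add_sub_cancel_right, hKy]
    · intro h
      set y := K.adjoint (μ • x - W x) with hy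
      have hA : A y = μ • K.adjoint x := by
        rw [hAapp, ← h, hy, map_sub, map_smul]; abel
      have : E.symm (μ • K.adjoint x) = y := by rw [← hA, ← hE]; simp
      rw [map_smul] at this
      rw [← map_smul, this, ← h]

open RealInnerProductSpace in
theorem exists_compact_of_memLp_kernel {α H : Type*} [MeasurableSpace α] {μ : Measure α}
    [NormedAddCommGroup H] [InnerProductSpace ℝ H] [CompleteSpace H] {k : α → H}
    (hk : MemLp k 2 μ) :
    ∃ K : H →L[ℝ] Lp ℝ 2 μ, IsCompactOperator K ∧ ∀ h, K h =ᵐ[μ] fun x => ⟪k x, h⟫ := by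
  have : Fact ((1 : ENNReal) ≤ 2) := ⟨by norm_num⟩
  -- the map sending a kernel to its operator
  let Φ : Lp H 2 μ →L[ℝ] H →L[ℝ] Lp ℝ 2 μ :=
    LinearMap.mkContinuous₂
      { toFun := fun κ =>
          { toFun := fun h => (innerSL ℝ h).compLp κ
            map_add' := fun x y => by
              rw [map_add, ContinuousLinearMap.add_compLp]
            map_smul' := fun c x => by
              rw [map_smul, ContinuousLinearMap.smul_compLp]; rfl }
        map_add' := fun κ κ' => by
          ext1 h; exact map_add ((innerSL ℝ h).compLpₗ 2 μ) κ κ'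
        map_smul' := fun c κ => by
          ext1 h; exact map_smul ((innerSL ℝ h).compLpₗ 2 μ) c κ } 1
      (fun κ h => by
        change ‖(innerSL ℝ h).compLp κ‖ ≤ _
        refine (ContinuousLinearMap.norm_compLp_le _ _).trans ?_
        rw [innerSL_apply_norm]
        linarith [mul_comm ‖h‖ ‖κ‖])
  have hΦ : ∀ κ h, Φ κ h =ᵐ[μ] fun x => ⟪κ x, h⟫ := fun κ h => by
    change (innerSL ℝ h).compLp κ =ᵐ[μ] _
    filter_upwards [(innerSL ℝ h).coeFn_compLp κ] with x hx
    rw [hx, innerSL_apply_apply, real_inner_comm]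
  have hcomp : ∀ κ, IsCompactOperator (Φ κ) := by
    refine Lp.induction (by norm_num) _ ?_ ?_ ?_
    · intro c s hs hμs
      have h1 : Φ (Lp.simpleFunc.indicatorConst 2 hs hμs.ne c) =
          (ContinuousLinearMap.toSpanSingleton ℝ (indicatorConstLp 2 hs hμs.ne (1 : ℝ))) ∘L
            innerSL ℝ c := by
        ext1 h
        refine Lp.ext ?_
        have h2 : ((innerSL ℝ c h) • indicatorConstLp 2 hs hμs.ne (1 : ℝ) : Lp ℝ 2 μ) =ᵐ[μ]
            (innerSL ℝ c h) • s.indicator fun _ => (1 : ℝ) :=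
          (Lp.coeFn_smul _ _).trans (indicatorConstLp_coeFn.fun_comp (innerSL ℝ c h * ·))
        refine (hΦ _ h).trans (EventuallyEq.trans ?_ h2.symm)
        rw [Lp.simpleFunc.coe_indicatorConst]
        filter_upwards [indicatorConstLp_coeFn (p := 2) (hs := hs) (hμs := hμs.ne) (c := c)]
          with x hx
        rw [hx]
        by_cases hxs : x ∈ s <;> simp [hxs]
      rw [h1]
      exact (isCompactOperator_of_locallyCompactSpace_rng (ContinuousLinearMap.toSpanSingleton ℝ
        (indicatorConstLp 2 hs hμs.ne (1 : ℝ)))).comp_clm _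
    · intro f g hf hg _ h1 h2
      rw [map_add]
      exact h1.add h2
    · exact isClosed_setOfPred_isCompactOperator.preimage Φ.continuous
  refine ⟨Φ (hk.toLp k), hcomp _, fun h => ?_⟩
  filter_upwards [hΦ (hk.toLp k) h, hk.coeFn_toLp] with x hx hx'
  rw [hx, hx']

open RealInnerProductSpace Topology in
theorem exists_compact_integral_operator {s : Set ℝ} (hs : MeasurableSet s)
    [IsFiniteMeasure (volume.restrict s)] {k : ℝ → ℝ → ℝ} {C : ℝ}
    (hk : AEStronglyMeasurable (Function.uncurry k)
      ((volume.restrict s).prod (volume.restrict s)))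
    (hC : ∀ x ∈ s, ∀ y ∈ s, |k x y| ≤ C)
    (hkx : ∀ x ∈ s, AEStronglyMeasurable (k x) (volume.restrict s))
    (hcont : ∀ x₀ ∈ s, ∀ᵐ y ∂(volume.restrict s),
      ContinuousWithinAt (fun x => k x y) s x₀) :
    ∃ K : Lp ℝ 2 (volume.restrict s) →L[ℝ] Lp ℝ 2 (volume.restrict s), IsCompactOperator K ∧
      (∀ h, K h =ᵐ[volume.restrict s] fun x => ∫ y in s, k x y * h y) ∧
      ∀ h, K.adjoint h =ᵐ[volume.restrict s] fun y => ∫ x in s, k x y * h x := by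
  classical
  set μ := volume.restrict s with hμ
  have hsμ : ∀ᵐ x ∂μ, x ∈ s := ae_restrict_mem hs
  have hmem : ∀ x ∈ s, MemLp (k x) 2 μ := fun x hx =>
    MemLp.of_bound (hkx x hx) C (hsμ.mono fun y hy => hC x hx y hy)
  let κ : ℝ → Lp ℝ 2 μ := fun x => if h : MemLp (k x) 2 μ then h.toLp else 0
  have hκ : ∀ x ∈ s, κ x =ᵐ[μ] k x := fun x hx => by
    simp only [κ, dif_pos (hmem x hx)]
    exact MemLp.coeFn_toLp _
  have hnorm : ∀ f : Lp ℝ 2 μ, ‖f‖ ^ 2 = ∫ y, (f y) ^ 2 ∂μ := fun f => by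
    rw [← real_inner_self_eq_norm_sq, L2.inner_def]
    exact integral_congr_ae (Eventually.of_forall fun y => by simp [sq])
  have hκcont : ContinuousOn κ s := by
    intro x₀ hx₀
    rw [ContinuousWithinAt, tendsto_iff_norm_sub_tendsto_zero]
    have h1 : Tendsto (fun x => ∫ y, (k x y - k x₀ y) ^ 2 ∂μ) (𝓝[s] x₀) (𝓝 (∫ _, (0:ℝ) ∂μ)) := by
      refine tendsto_integral_filter_of_dominated_convergence (fun _ => (2 * C) ^ 2) ?_ ?_
        (integrable_const _) ?_
      · filter_upwards [self_mem_nhdsWithin] with x hx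
        exact ((hkx x hx).sub (hkx x₀ hx₀)).pow 2
      · filter_upwards [self_mem_nhdsWithin] with x hx
        filter_upwards [hsμ] with y hy
        rw [Real.norm_eq_abs, abs_pow]
        have := abs_sub (k x y) (k x₀ y)
        gcongr
        linarith [hC x hx y hy, hC x₀ hx₀ y hy]
      · filter_upwards [hcont x₀ hx₀] with y hy
        have : Tendsto (fun x => (k x y - k x₀ y) ^ 2) (𝓝[s] x₀) (𝓝 ((k x₀ y - k x₀ y) ^ 2)) :=
          (hy.tendsto.sub_const _).pow 2
        simpa using this
    rw [integral_zero] at h1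
    have h2 : Tendsto (fun x => ‖κ x - κ x₀‖ ^ 2) (𝓝[s] x₀) (𝓝 0) := by
      refine h1.congr' ?_
      filter_upwards [self_mem_nhdsWithin] with x hx
      rw [hnorm]
      refine integral_congr_ae ?_
      filter_upwards [hκ x hx, hκ x₀ hx₀, Lp.coeFn_sub (κ x) (κ x₀)] with y h1 h2 h3
      rw [h3, Pi.sub_apply, h1, h2]
    have h3 := h2.sqrt
    simpa using h3
  have hκmem : MemLp κ 2 μ := by
    refine MemLp.of_bound (hκcont.aestronglyMeasurable hs) (√(∫ _, C ^ 2 ∂μ)) ?_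
    filter_upwards [hsμ] with x hx
    refine Real.le_sqrt_of_sq_le ?_
    rw [hnorm]
    refine integral_mono_ae ?_ (integrable_const _) ?_
    · exact ((memLp_two_iff_integrable_sq (Lp.aestronglyMeasurable _)).1 (Lp.memLp _))
    · filter_upwards [hκ x hx, hsμ] with y hy hys
      rw [hy]
      exact sq_le_sq' (abs_le.1 (hC x hx y hys)).1 (abs_le.1 (hC x hx y hys)).2
  obtain ⟨K, hKc, hK⟩ := exists_compact_of_memLp_kernel hκmem
  have hK' : ∀ h, K h =ᵐ[μ] fun x => ∫ y, k x y * h y ∂μ := fun h => by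
    filter_upwards [hK h, hsμ] with x hx hxs
    rw [hx, L2.inner_def]
    refine integral_congr_ae ?_
    filter_upwards [hκ x hxs] with y hy
    rw [hy]; simp [mul_comm]
  refine ⟨K, hKc, hK', fun h => ?_⟩
  have hint : ∀ f : Lp ℝ 2 μ, Integrable f μ := fun f =>
    (Lp.memLp f).integrable (by norm_num)
  have hprod : ∀ g : Lp ℝ 2 μ,
      Integrable (Function.uncurry fun x y => k x y * g y * h x) (μ.prod μ) := fun g => by
    have h1 := (hint h).mul_prod (hint g)
    refine (h1.bdd_mul (c := C) hk ?_).congr ?_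
    · rw [Measure.prod_restrict, ae_restrict_iff' (hs.prod hs)]
      exact Eventually.of_forall fun z hz => hC _ hz.1 _ hz.2
    · exact Eventually.of_forall fun z => by simp [Function.uncurry]; ring
  have hmeas : AEStronglyMeasurable (fun y => ∫ x, k x y * h x ∂μ) μ := by
    have h1 : AEStronglyMeasurable (fun z : ℝ × ℝ => k z.2 z.1 * h z.2) (μ.prod μ) :=
      (hk.prod_swap).mul (Lp.aestronglyMeasurable h).comp_snd
    exact h1.integral_prod_right'
  have hadj : MemLp (fun y => ∫ x, k x y * h x ∂μ) 2 μ := by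
    refine MemLp.of_bound hmeas (∫ x, C * ‖h x‖ ∂μ) ?_
    filter_upwards [hsμ] with y hy
    refine norm_integral_le_of_norm_le ((hint h).norm.const_mul C) ?_
    filter_upwards [hsμ] with x hx
    rw [norm_mul]
    gcongr
    exact hC x hx y hy
  have : K.adjoint h = hadj.toLp := by
    refine ext_inner_left ℝ fun g => ?_
    rw [ContinuousLinearMap.adjoint_inner_right, L2.inner_def, L2.inner_def]
    calc ∫ x, ⟪K g x, h x⟫ ∂μ = ∫ x, ∫ y, k x y * g y * h x ∂μ ∂μ := by
          refine integral_congr_ae ?_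
          filter_upwards [hK' g] with x hx
          rw [hx, integral_mul_const]; simp [mul_comm]
      _ = ∫ y, ∫ x, k x y * g y * h x ∂μ ∂μ := integral_integral_swap (hprod g)
      _ = _ := by
          refine integral_congr_ae ?_
          filter_upwards [hadj.coeFn_toLp] with y hy
          rw [hy]
          simp only [RCLike.inner_apply, conj_trivial]
          rw [← integral_mul_const]
          exact integral_congr_ae (Eventually.of_forall fun x => by ring)
  rw [this]
  exact hadj.coeFn_toLp

open Topology in
theorem hasDerivAt_setIntegral_Ioo_left {a b : ℝ} {f : ℝ → ℝ} (hf : ContinuousOn f (Ioo a b))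
    (hi : ∀ c ∈ Ioo a b, IntegrableOn f (Ioo c b)) {x : ℝ} (hx : x ∈ Ioo a b) :
    HasDerivAt (fun x => ∫ y in Ioo x b, f y) (-f x) x := by
  have h1 : HasDerivAt (fun x => ∫ y in x..b, f y) (-f x) x := by
    refine intervalIntegral.integral_hasDerivAt_left ?_ ?_
      (hf.continuousAt (isOpen_Ioo.mem_nhds hx))
    · exact (intervalIntegrable_iff_integrableOn_Ioo_of_le hx.2.le).2 (hi x hx)
    · exact hf.stronglyMeasurableAtFilter isOpen_Ioo x hx
  refine h1.congr_of_eventuallyEq ?_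
  filter_upwards [isOpen_Ioo.mem_nhds hx] with y hy
  rw [intervalIntegral.integral_of_le hy.2.le, integral_Ioc_eq_integral_Ioo]

open Topology in
theorem hasDerivAt_setIntegral_Ioo_right {a b : ℝ} {f : ℝ → ℝ} (hf : ContinuousOn f (Ioo a b))
    (hi : ∀ c ∈ Ioo a b, IntegrableOn f (Ioo a c)) {x : ℝ} (hx : x ∈ Ioo a b) :
    HasDerivAt (fun x => ∫ y in Ioo a x, f y) (f x) x := by
  have h1 : HasDerivAt (fun x => ∫ y in a..x, f y) (f x) x := by
    refine intervalIntegral.integral_hasDerivAt_right ?_ ?_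
      (hf.continuousAt (isOpen_Ioo.mem_nhds hx))
    · exact (intervalIntegrable_iff_integrableOn_Ioo_of_le hx.1.le).2 (hi x hx)
    · exact hf.stronglyMeasurableAtFilter isOpen_Ioo x hx
  refine h1.congr_of_eventuallyEq ?_
  filter_upwards [isOpen_Ioo.mem_nhds hx] with y hy
  rw [intervalIntegral.integral_of_le hy.1.le, integral_Ioc_eq_integral_Ioo]

theorem continuousOn_setIntegral_Ioo_right {a b : ℝ} {f : ℝ → ℝ}
    (hi : ∀ c ∈ Ioo a b, IntegrableOn f (Ioo a c)) :
    ContinuousOn (fun x => ∫ y in Ioo a x, f y) (Ioo a b) := by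
  intro x hx
  obtain ⟨c, hxc, hcb⟩ := exists_between hx.2
  have h1 : ContinuousOn (fun x => ∫ y in a..x, f y) (uIcc a c) :=
    intervalIntegral.continuousOn_primitive_interval (by
      rw [uIcc_of_le (hx.1.trans hxc).le, integrableOn_Icc_iff_integrableOn_Ioo]
      exact hi c ⟨hx.1.trans hxc, hcb⟩)
  rw [uIcc_of_le (hx.1.trans hxc).le] at h1
  have h2 := h1.continuousAt (Icc_mem_nhds hx.1 hxc)
  refine (h2.congr ?_).continuousWithinAt
  filter_upwards [isOpen_Ioo.mem_nhds hx] with y hy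
  rw [intervalIntegral.integral_of_le hy.1.le, integral_Ioc_eq_integral_Ioo]

theorem integrableOn_Ioo_of_integral_le {a b C : ℝ} {E : ℝ → ℝ} (hE : ContinuousOn E (Ioo a b))
    (hpos : ∀ x ∈ Ioo a b, 0 ≤ E x)
    (hC : ∀ x₁ ∈ Ioo a b, ∀ x₂ ∈ Ioo a b, x₁ < x₂ → ∫ x in x₁..x₂, E x ≤ C) :
    IntegrableOn E (Ioo a b) := by
  rcases le_or_gt b a with hab | hab
  · simp [Ioo_eq_empty (not_lt.2 hab)]
  set δ : ℕ → ℝ := fun n => (b - a) / (n + 3) with hδ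
  have hδ0 : Tendsto δ atTop (nhds 0) :=
    tendsto_const_nhds.div_atTop (tendsto_natCast_atTop_atTop.atTop_add tendsto_const_nhds)
  have hba := sub_pos.2 hab
  have hδpos : ∀ n, 0 < δ n := fun n => by positivity
  have hδle : ∀ n, δ n * 3 ≤ b - a := fun n => by
    have : δ n * (n + 3) = b - a := by simp only [hδ]; field_simp
    nlinarith [hδpos n, Nat.cast_nonneg (α := ℝ) n]
  have hmem : ∀ n, Icc (a + δ n) (b - δ n) ⊆ Ioo a b := fun n z hz =>
    ⟨by linarith [hz.1, hδpos n], by linarith [hz.2, hδpos n]⟩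
  have hlt : ∀ n, a + δ n < b - δ n := fun n => by linarith [hδle n, hδpos n]
  rw [← integrableOn_Ioc_iff_integrableOn_Ioo]
  refine integrableOn_Ioc_of_intervalIntegral_norm_bounded (l := atTop) (a := fun n => a + δ n)
    (b := fun n => b - δ n) (I := C) (fun n => ?_) ?_ ?_ (Eventually.of_forall fun n => ?_)
  · exact ((hE.mono (hmem n)).integrableOn_Icc).mono_set Ioc_subset_Icc_self
  · simpa using hδ0.const_add a
  · simpa using hδ0.const_sub b
  · rw [← intervalIntegral.integral_of_le (hlt n).le]
    refine le_of_eq_of_le (intervalIntegral.integral_congr fun x hx => ?_)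
      (hC _ (hmem n ⟨le_rfl, (hlt n).le⟩) _ (hmem n ⟨(hlt n).le, le_rfl⟩) (hlt n))
    rw [uIcc_of_le (hlt n).le] at hx
    exact Real.norm_of_nonneg (hpos x (hmem n hx))

/-- `u` is a positive, strictly increasing solution of `u'' = p u` on `(a, b)`, with `p` continuous
and nonnegative. -/
structure IsIncreasingSolution (a b : ℝ) (u u' p : ℝ → ℝ) : Prop where
  lt : a < b
  pos : ∀ x ∈ Ioo a b, 0 < u x
  deriv_pos : ∀ x ∈ Ioo a b, 0 < u' x
  potential_nonneg : ∀ x ∈ Ioo a b, 0 ≤ p x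
  potential_continuousOn : ContinuousOn p (Ioo a b)
  hasDerivAt : ∀ x ∈ Ioo a b, HasDerivAt u (u' x) x
  hasDerivAt_deriv : ∀ x ∈ Ioo a b, HasDerivAt u' (p x * u x) x

/-- The inverse of `u (d/dx) u⁻¹` (up to sign) with zero boundary value at `b`. -/
noncomputable def backwardOp (b : ℝ) (u h : ℝ → ℝ) (x : ℝ) : ℝ := u x * ∫ y in Ioo x b, h y / u y

/-- The inverse of `u⁻¹ (d/dx) u` with zero boundary value at `a`. -/
noncomputable def forwardOp (a : ℝ) (u h : ℝ → ℝ) (y : ℝ) : ℝ := (∫ x in Ioo a y, u x * h x) / u y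

namespace IsIncreasingSolution

variable {a b : ℝ} {u u' p : ℝ → ℝ} (S : IsIncreasingSolution a b u u' p)
include S

theorem continuousOn : ContinuousOn u (Ioo a b) :=
  fun x hx => (S.hasDerivAt x hx).continuousAt.continuousWithinAt

theorem continuousOn_deriv : ContinuousOn u' (Ioo a b) :=
  fun x hx => (S.hasDerivAt_deriv x hx).continuousAt.continuousWithinAt

theorem ne_zero {x : ℝ} (hx : x ∈ Ioo a b) : u x ≠ 0 := (S.pos x hx).ne'

theorem monotoneOn : MonotoneOn u (Ioo a b) := by
  refine (strictMonoOn_of_deriv_pos (convex_Ioo a b) S.continuousOn fun x hx => ?_).monotoneOn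
  rw [interior_Ioo] at hx
  rw [(S.hasDerivAt x hx).deriv]
  exact S.deriv_pos x hx

theorem integrableOn_div {h : ℝ → ℝ} (hh : IntegrableOn h (Ioo a b)) {c : ℝ} (hc : c ∈ Ioo a b) :
    IntegrableOn (fun y => h y / u y) (Ioo c b) := by
  have hsub : Ioo c b ⊆ Ioo a b := Ioo_subset_Ioo_left hc.1.le
  have h1 : IntegrableOn (fun y => (u y)⁻¹ * h y) (Ioo c b) := by
    refine (hh.mono_set hsub).bdd_mul (c := (u c)⁻¹) ?_ ?_
    · exact ((S.continuousOn.mono hsub).inv₀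
        fun x hx => S.ne_zero (hsub hx)).aestronglyMeasurable measurableSet_Ioo
    · refine (ae_restrict_iff' measurableSet_Ioo).2 (Eventually.of_forall fun y hy => ?_)
      rw [Real.norm_eq_abs, abs_of_pos (inv_pos.2 (S.pos y (hsub hy)))]
      exact inv_anti₀ (S.pos c hc) (S.monotoneOn hc (hsub hy) hy.1.le)
  exact h1.congr_fun (fun y _ => by ring) measurableSet_Ioo

theorem integrableOn_mul {h : ℝ → ℝ} (hh : IntegrableOn h (Ioo a b)) {c : ℝ} (hc : c ∈ Ioo a b) :
    IntegrableOn (fun y => u y * h y) (Ioo a c) := by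
  have hsub : Ioo a c ⊆ Ioo a b := Ioo_subset_Ioo_right hc.2.le
  refine (hh.mono_set hsub).bdd_mul (c := u c) ?_ ?_
  · exact (S.continuousOn.mono hsub).aestronglyMeasurable measurableSet_Ioo
  · refine (ae_restrict_iff' measurableSet_Ioo).2 (Eventually.of_forall fun y hy => ?_)
    rw [Real.norm_eq_abs, abs_of_pos (S.pos y (hsub hy))]
    exact S.monotoneOn (hsub hy) hc hy.2.le

theorem continuousOn_forwardOp {h : ℝ → ℝ} (hh : IntegrableOn h (Ioo a b)) :
    ContinuousOn (forwardOp a u h) (Ioo a b) :=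
  (continuousOn_setIntegral_Ioo_right fun _ hc => S.integrableOn_mul hh hc).div S.continuousOn
    fun _ hx => S.ne_zero hx

theorem integrableOn_inv_sq {c : ℝ} (hc : c ∈ Ioo a b) :
    IntegrableOn (fun y => (u y ^ 2)⁻¹) (Ioo c b) := by
  have h1 : IntegrableOn (fun _ : ℝ => (1 : ℝ)) (Ioo a b) := by simp
  have hsub : Ioo c b ⊆ Ioo a b := Ioo_subset_Ioo_left hc.1.le
  have h2 : IntegrableOn (fun y => (u y)⁻¹ * (1 / u y)) (Ioo c b) := by
    refine (S.integrableOn_div h1 hc).bdd_mul (c := (u c)⁻¹) ?_ ?_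
    · exact ((S.continuousOn.mono hsub).inv₀
        fun x hx => S.ne_zero (hsub hx)).aestronglyMeasurable measurableSet_Ioo
    · refine (ae_restrict_iff' measurableSet_Ioo).2 (Eventually.of_forall fun y hy => ?_)
      rw [Real.norm_eq_abs, abs_of_pos (inv_pos.2 (S.pos y (hsub hy)))]
      exact inv_anti₀ (S.pos c hc) (S.monotoneOn hc (hsub hy) hy.1.le)
  exact h2.congr_fun (fun y _ => by simp only []; rw [one_div, ← mul_inv, sq]) measurableSet_Ioo

theorem integral_inv_sq_le {x : ℝ} (hx : x ∈ Ioo a b) :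
    ∫ y in Ioo x b, (u y ^ 2)⁻¹ ≤ (u x * u' x)⁻¹ := by
  set Ψ : ℝ → ℝ := fun x => (u x * u' x)⁻¹ - ∫ y in Ioo x b, (u y ^ 2)⁻¹ with hΨ
  have hpos : ∀ y ∈ Ioo a b, 0 < u y * u' y := fun y hy => mul_pos (S.pos y hy) (S.deriv_pos y hy)
  have hcont : ContinuousOn (fun y => (u y ^ 2)⁻¹) (Ioo a b) :=
    (S.continuousOn.pow 2).inv₀ fun y hy => pow_ne_zero 2 (S.ne_zero hy)
  have hd : ∀ y ∈ Ioo a b, HasDerivAt Ψ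
      (-(u' y * u' y + u y * (p y * u y)) / (u y * u' y) ^ 2 - -(u y ^ 2)⁻¹) y := fun y hy =>
    (((S.hasDerivAt y hy).mul (S.hasDerivAt_deriv y hy)).inv (hpos y hy).ne').sub
      (hasDerivAt_setIntegral_Ioo_left hcont (fun c hc => S.integrableOn_inv_sq hc) hy)
  have hanti : AntitoneOn Ψ (Ioo a b) := by
    refine antitoneOn_of_deriv_nonpos (convex_Ioo a b)
      (fun y hy => (hd y hy).continuousAt.continuousWithinAt)
      (fun y hy => ?_) fun y hy => ?_
    · rw [interior_Ioo] at hy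
      exact (hd y hy).differentiableAt.differentiableWithinAt
    · rw [interior_Ioo] at hy
      rw [(hd y hy).deriv]
      have h1 := S.pos y hy
      have h2 := S.deriv_pos y hy
      have h3 : -(u' y * u' y + u y * (p y * u y)) / (u y * u' y) ^ 2 - -(u y ^ 2)⁻¹ =
          -(p y / u' y ^ 2) := by field_simp; ring
      rw [h3, neg_nonpos]
      exact div_nonneg (S.potential_nonneg y hy) (sq_nonneg _)
  have hlow : ∀ y ∈ Ioo x b, -((b - y) * (u x ^ 2)⁻¹) ≤ Ψ x := by
    intro y hy
    have hy' : y ∈ Ioo a b := ⟨hx.1.trans hy.1, hy.2⟩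
    refine le_trans ?_ (hanti hx hy' hy.1.le)
    have h1 : ∫ z in Ioo y b, (u z ^ 2)⁻¹ ≤ ∫ z in Ioo y b, (u x ^ 2)⁻¹ := by
      refine setIntegral_mono_on (S.integrableOn_inv_sq hy') (by simp) measurableSet_Ioo ?_
      intro z hz
      have hz' : z ∈ Ioo a b := ⟨hy'.1.trans hz.1, hz.2⟩
      have := S.pos x hx
      have := S.monotoneOn hx hz' (hy.1.trans hz.1).le
      gcongr
    rw [setIntegral_const, smul_eq_mul] at h1
    simp only [measureReal_def, Real.volume_Ioo, ENNReal.toReal_ofReal (sub_nonneg.2 hy.2.le)] at h1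
    have h2 := inv_pos.2 (hpos y hy')
    simp only [hΨ]
    linarith
  have hlim : Tendsto (fun y => -((b - y) * (u x ^ 2)⁻¹)) (nhdsWithin b (Iio b))
      (nhds (-((b - b) * (u x ^ 2)⁻¹))) :=
    (Continuous.tendsto (by fun_prop) b).mono_left nhdsWithin_le_nhds
  have : -((b - b) * (u x ^ 2)⁻¹) ≤ Ψ x :=
    le_of_tendsto hlim (by filter_upwards [Ioo_mem_nhdsLT hx.2] with y hy using hlow y hy)
  simp only [sub_self, zero_mul, neg_zero, hΨ] at this
  linarith

theorem mul_sq_integral_div_le {H : ℝ → ℝ} (hH : IntegrableOn H (Ioo a b))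
    (hH2 : IntegrableOn (fun y => H y ^ 2) (Ioo a b)) {x : ℝ} (hx : x ∈ Ioo a b) :
    u x * u' x * (∫ y in Ioo x b, H y / u y) ^ 2 ≤ ∫ y in Ioo a b, H y ^ 2 := by
  set G := ∫ y in Ioo x b, H y / u y
  set d := u x * u' x with hd
  have hdpos : 0 < d := mul_pos (S.pos x hx) (S.deriv_pos x hx)
  have hsub : Ioo x b ⊆ Ioo a b := Ioo_subset_Ioo_left hx.1.le
  have i1 := hH2.mono_set hsub
  have i2 := (S.integrableOn_div hH hx).const_mul (2 * (d * G))
  have i3 := (S.integrableOn_inv_sq hx).const_mul ((d * G) ^ 2)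
  have h1 : 0 ≤ ∫ y in Ioo x b, (H y ^ 2 - 2 * (d * G) * (H y / u y) +
      (d * G) ^ 2 * (u y ^ 2)⁻¹) := by
    refine setIntegral_nonneg measurableSet_Ioo fun y hy => ?_
    have : H y ^ 2 - 2 * (d * G) * (H y / u y) + (d * G) ^ 2 * (u y ^ 2)⁻¹ =
      (H y - d * G / u y) ^ 2 := by
      have := S.ne_zero (hsub hy)
      field_simp
      ring
    rw [this]; positivity
  have i12 : IntegrableOn (fun y => H y ^ 2 - 2 * (d * G) * (H y / u y)) (Ioo x b) := i1.sub i2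
  rw [integral_add i12 i3, integral_sub i1 i2, integral_const_mul, integral_const_mul] at h1
  have h2 : ∫ y in Ioo x b, H y ^ 2 ≤ ∫ y in Ioo a b, H y ^ 2 :=
    setIntegral_mono_set hH2 (Eventually.of_forall fun y => sq_nonneg _) hsub.eventuallyLE
  have h3 : (d * G) ^ 2 * ∫ y in Ioo x b, (u y ^ 2)⁻¹ ≤ d * G ^ 2 := by
    calc _ ≤ (d * G) ^ 2 * d⁻¹ := by
          gcongr
          exact S.integral_inv_sq_le hx
      _ = d * G ^ 2 := by field_simp
  have h4 : 2 * (d * G) * G = 2 * (d * G ^ 2) := by ring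
  linarith

theorem abs_forwardOp_le {h : ℝ → ℝ} (hh : IntegrableOn h (Ioo a b)) {y : ℝ} (hy : y ∈ Ioo a b) :
    |forwardOp a u h y| ≤ ∫ x in Ioo a b, |h x| := by
  have hsub : Ioo a y ⊆ Ioo a b := Ioo_subset_Ioo_right hy.2.le
  have hu := S.pos y hy
  rw [forwardOp, abs_div, abs_of_pos hu, div_le_iff₀ hu]
  calc |∫ x in Ioo a y, u x * h x| ≤ ∫ x in Ioo a y, |u x * h x| := abs_integral_le_integral_abs
    _ ≤ ∫ x in Ioo a y, |h x| * u y := by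
      refine setIntegral_mono_on (S.integrableOn_mul hh hy).abs
        ((hh.mono_set hsub).abs.mul_const _) measurableSet_Ioo fun x hx => ?_
      rw [abs_mul, abs_of_pos (S.pos x (hsub hx)), mul_comm]
      have := S.monotoneOn (hsub hx) hy hx.2.le
      gcongr
    _ = (∫ x in Ioo a y, |h x|) * u y := integral_mul_const _ _
    _ ≤ _ := by
      have : ∫ x in Ioo a y, |h x| ≤ ∫ x in Ioo a b, |h x| :=
        setIntegral_mono_set hh.abs (Eventually.of_forall fun _ => abs_nonneg _) hsub.eventuallyLE
      gcongr

theorem hasDerivAt_forwardOp {f : ℝ → ℝ} (hf : ContinuousOn f (Ioo a b))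
    (hi : IntegrableOn f (Ioo a b)) {x : ℝ} (hx : x ∈ Ioo a b) :
    HasDerivAt (forwardOp a u f) (f x - forwardOp a u f x * (u' x / u x)) x := by
  have h1 := hasDerivAt_setIntegral_Ioo_right (S.continuousOn.mul hf)
    (fun c hc => S.integrableOn_mul hi hc) hx
  have h2 := h1.div (S.hasDerivAt x hx) (S.ne_zero hx)
  refine h2.congr_deriv ?_
  have := S.ne_zero hx
  simp only [forwardOp, Pi.mul_apply]
  field_simp

theorem hasDerivAt_integral_div {H : ℝ → ℝ} (hH : ContinuousOn H (Ioo a b))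
    (hi : IntegrableOn H (Ioo a b)) {x : ℝ} (hx : x ∈ Ioo a b) :
    HasDerivAt (fun x => ∫ y in Ioo x b, H y / u y) (-(H x / u x)) x :=
  hasDerivAt_setIntegral_Ioo_left (hH.div S.continuousOn fun _ hy => S.ne_zero hy)
    (fun _ hc => S.integrableOn_div hi hc) hx

theorem hasDerivAt_backwardOp {H : ℝ → ℝ} (hH : ContinuousOn H (Ioo a b))
    (hi : IntegrableOn H (Ioo a b)) {x : ℝ} (hx : x ∈ Ioo a b) :
    HasDerivAt (backwardOp b u H) (u' x * (∫ y in Ioo x b, H y / u y) - H x) x := by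
  refine ((S.hasDerivAt x hx).mul (S.hasDerivAt_integral_div hH hi hx)).congr_deriv ?_
  have := S.ne_zero hx
  field_simp
  ring

theorem integrableOn_forwardOp {f : ℝ → ℝ} (hi : IntegrableOn f (Ioo a b)) :
    IntegrableOn (forwardOp a u f) (Ioo a b) :=
  IntegrableOn.of_bound (by simp)
    ((S.continuousOn_forwardOp hi).aestronglyMeasurable measurableSet_Ioo)
    (∫ x in Ioo a b, |f x|)
    ((ae_restrict_iff' measurableSet_Ioo).2 (Eventually.of_forall fun _ hy =>
      S.abs_forwardOp_le hi hy))

theorem integrableOn_forwardOp_sq {f : ℝ → ℝ} (hi : IntegrableOn f (Ioo a b)) :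
    IntegrableOn (fun y => forwardOp a u f y ^ 2) (Ioo a b) :=
  IntegrableOn.of_bound (by simp)
    (((S.continuousOn_forwardOp hi).pow 2).aestronglyMeasurable measurableSet_Ioo)
    ((∫ x in Ioo a b, |f x|) ^ 2)
    ((ae_restrict_iff' measurableSet_Ioo).2 (Eventually.of_forall fun y hy => by
      rw [norm_pow, Real.norm_eq_abs]
      exact pow_le_pow_left₀ (abs_nonneg _) (S.abs_forwardOp_le hi hy) 2))

/-- `backwardOp ∘ forwardOp` is a right inverse of `-d²/dx² + p` with values in the functions of
finite energy. -/
theorem exists_green {f : ℝ → ℝ} (hf : ContinuousOn f (Ioo a b)) (hi : IntegrableOn f (Ioo a b)) :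
    ∃ φ' : ℝ → ℝ,
      (∀ x ∈ Ioo a b, HasDerivAt (backwardOp b u (forwardOp a u f)) (φ' x) x) ∧
      (∀ x ∈ Ioo a b, HasDerivAt φ' (p x * backwardOp b u (forwardOp a u f) x - f x) x) ∧
      IntegrableOn (fun x => φ' x ^ 2 + p x * backwardOp b u (forwardOp a u f) x ^ 2)
        (Ioo a b) := by
  set H := forwardOp a u f with hHdef
  set G : ℝ → ℝ := fun x => ∫ y in Ioo x b, H y / u y with hG
  have hH := S.continuousOn_forwardOp hi
  have hHi := S.integrableOn_forwardOp hi
  have hH2 := S.integrableOn_forwardOp_sq hi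
  have hGd : ∀ x ∈ Ioo a b, HasDerivAt G (-(H x / u x)) x :=
    fun x hx => S.hasDerivAt_integral_div hH hHi hx
  have hGc : ContinuousOn G (Ioo a b) :=
    fun x hx => (hGd x hx).continuousAt.continuousWithinAt
  refine ⟨fun x => u' x * G x - H x, fun x hx => S.hasDerivAt_backwardOp hH hHi hx,
    fun x hx => ?_, ?_⟩
  · refine (((S.hasDerivAt_deriv x hx).mul (hGd x hx)).sub
      (S.hasDerivAt_forwardOp hf hi hx)).congr_deriv ?_
    have := S.ne_zero hx
    simp only [backwardOp, hG]
    field_simp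
    ring
  · set D : ℝ → ℝ := fun x => u' x ^ 2 * G x ^ 2 + p x * u x ^ 2 * G x ^ 2 - 2 * u' x * G x * H x
      with hD
    have hDc : ContinuousOn D (Ioo a b) :=
      (((S.continuousOn_deriv.pow 2).mul (hGc.pow 2)).add
        ((S.potential_continuousOn.mul (S.continuousOn.pow 2)).mul (hGc.pow 2))).sub
        (((continuousOn_const.mul S.continuousOn_deriv).mul hGc).mul hH)
    have hDd : ∀ x ∈ Ioo a b, HasDerivAt (fun x => u x * u' x * G x ^ 2) (D x) x := fun x hx => by
      refine (((S.hasDerivAt x hx).mul (S.hasDerivAt_deriv x hx)).mul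
        ((hGd x hx).pow 2)).congr_deriv ?_
      have := S.ne_zero hx
      simp only [hD, Pi.mul_apply, Pi.pow_apply]
      field_simp
      ring
    have hE : (fun x => (u' x * G x - H x) ^ 2 + p x * backwardOp b u H x ^ 2) =
        fun x => H x ^ 2 + D x := by
      funext x
      simp only [hD, backwardOp, hG]
      ring
    rw [hE]
    refine integrableOn_Ioo_of_integral_le (C := 2 * ∫ y in Ioo a b, H y ^ 2)
      ((hH.pow 2).add hDc) (fun x hx => ?_) fun x₁ h₁ x₂ h₂ h₁₂ => ?_
    · refine le_of_le_of_eq ?_ (congr_fun hE x)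
      have := S.potential_nonneg x hx
      positivity
    · have hsub : uIcc x₁ x₂ ⊆ Ioo a b := by
        rw [uIcc_of_le h₁₂.le]
        exact fun z hz => ⟨h₁.1.trans_le hz.1, hz.2.trans_lt h₂.2⟩
      have hHI : IntervalIntegrable (fun x => H x ^ 2) volume x₁ x₂ :=
        ((hH.pow 2).mono hsub).intervalIntegrable
      rw [intervalIntegral.integral_add hHI
        (hDc.mono hsub).intervalIntegrable,
        intervalIntegral.integral_eq_sub_of_hasDerivAt (fun x hx => hDd x (hsub hx))
        (hDc.mono hsub).intervalIntegrable]
      have e1 : ∫ x in x₁..x₂, H x ^ 2 ≤ ∫ y in Ioo a b, H y ^ 2 := by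
        rw [intervalIntegral.integral_of_le h₁₂.le]
        refine setIntegral_mono_set hH2 (Eventually.of_forall fun _ => sq_nonneg _)
          (LE.le.eventuallyLE ?_)
        exact fun z hz => ⟨h₁.1.trans hz.1, hz.2.trans_lt h₂.2⟩
      have e2 := S.mul_sq_integral_div_le hHi hH2 h₂
      have e3 : 0 ≤ u x₁ * u' x₁ * G x₁ ^ 2 := by
        have := S.pos x₁ h₁
        have := S.deriv_pos x₁ h₁
        positivity
      linarith

end IsIncreasingSolution

theorem eqOn_zero_of_linear_ode {a b x₀ : ℝ} {r z z' : ℝ → ℝ} (hr : ContinuousOn r (Ioo a b))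
    (hz : ∀ x ∈ Ioo a b, HasDerivAt z (z' x) x)
    (hz' : ∀ x ∈ Ioo a b, HasDerivAt z' (r x * z x) x)
    (hx₀ : x₀ ∈ Ioo a b) (h0 : z x₀ = 0) (h0' : z' x₀ = 0) : ∀ x ∈ Ioo a b, z x = 0 := by
  intro x hx
  obtain ⟨c, hac, hc⟩ := exists_between (lt_min hx₀.1 hx.1)
  obtain ⟨d, hd, hdb⟩ := exists_between (max_lt hx₀.2 hx.2)
  rw [lt_min_iff] at hc
  rw [max_lt_iff] at hd
  have hsub : Icc c d ⊆ Ioo a b := fun y hy => ⟨hac.trans_le hy.1, hy.2.trans_lt hdb⟩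
  obtain ⟨M, hM⟩ := isCompact_Icc.exists_bound_of_continuousOn (hr.mono hsub)
  have hM' : ∀ t ∈ Ioo c d, ‖r t‖ ≤ M := fun t ht => hM t (Ioo_subset_Icc_self ht)
  set v : ℝ → ℝ × ℝ → ℝ × ℝ := fun t y => (y.2, r t * y.1) with hv
  have hlip : ∀ t ∈ Ioo c d, LipschitzOnWith (max 1 M).toNNReal (v t) univ := by
    intro t ht
    refine LipschitzOnWith.of_dist_le_mul fun y _ w _ => ?_
    rw [Real.coe_toNNReal _ (le_max_of_le_left zero_le_one), Prod.dist_eq, Prod.dist_eq]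
    have e1 : dist (r t * y.1) (r t * w.1) = ‖r t‖ * dist y.1 w.1 := by
      rw [Real.dist_eq, Real.dist_eq, ← mul_sub, abs_mul, Real.norm_eq_abs]
    simp only [hv, e1]
    refine max_le ?_ ?_
    · calc dist y.2 w.2 ≤ max (dist y.1 w.1) (dist y.2 w.2) := le_max_right _ _
        _ ≤ _ := le_mul_of_one_le_left (le_max_of_le_left dist_nonneg) (le_max_left _ _)
    · have h1 : ‖r t‖ ≤ max 1 M := (hM' t ht).trans (le_max_right _ _)
      exact mul_le_mul h1 (le_max_left _ _) dist_nonneg (le_max_of_le_left zero_le_one)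
  have key := ODE_solution_unique_of_mem_Ioo (v := v) (s := fun _ => univ) hlip ⟨hc.1, hd.1⟩
    (f := fun t => (z t, z' t)) (g := fun _ => (0, 0))
    (fun t ht => ⟨(hz t (hsub (Ioo_subset_Icc_self ht))).prodMk
      (hz' t (hsub (Ioo_subset_Icc_self ht))), mem_univ _⟩)
    (fun t _ =>
      ⟨(hasDerivAt_const t ((0 : ℝ), (0 : ℝ))).congr_deriv (by simp [hv]; rfl), mem_univ _⟩)
    (by simp [h0, h0'])
  exact congrArg Prod.fst (key ⟨hc.2, hd.2⟩)

theorem monotoneOn_mul_deriv {s : Set ℝ} (hs : Convex ℝ s) {ρ z z' : ℝ → ℝ}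
    (hρ : ∀ x ∈ s, 0 ≤ ρ x) (hz : ∀ x ∈ s, HasDerivAt z (z' x) x)
    (hz' : ∀ x ∈ s, HasDerivAt z' (ρ x * z x) x) : MonotoneOn (fun x => z x * z' x) s := by
  have hd : ∀ x ∈ s, HasDerivAt (fun x => z x * z' x) (z' x * z' x + z x * (ρ x * z x)) x :=
    fun x hx => (hz x hx).mul (hz' x hx)
  refine monotoneOn_of_deriv_nonneg hs (fun x hx => (hd x hx).continuousAt.continuousWithinAt)
    (fun x hx => (hd x (interior_subset hx)).differentiableAt.differentiableWithinAt)
    fun x hx => ?_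
  rw [(hd x (interior_subset hx)).deriv]
  have := hρ x (interior_subset hx)
  have h1 : z x * (ρ x * z x) = ρ x * z x ^ 2 := by ring
  rw [h1]
  nlinarith [mul_self_nonneg (z' x), mul_nonneg this (sq_nonneg (z x))]

theorem integrableOn_of_mul_sq {s : Set ℝ} (hs : MeasurableSet s) {p z : ℝ → ℝ} {c : ℝ}
    (hp : ContinuousOn p s) (hp0 : ∀ x ∈ s, 0 ≤ p x)
    (hpz : IntegrableOn (fun x => p x * z x ^ 2) s) (hc : c ≠ 0)
    (hcz : ∀ x ∈ s, c ^ 2 ≤ z x ^ 2) : IntegrableOn p s := by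
  refine Integrable.mono' (hpz.const_mul (c ^ 2)⁻¹) (hp.aestronglyMeasurable hs)
    ((ae_restrict_iff' hs).2 (Eventually.of_forall fun x hx => ?_))
  have h1 : 0 < c ^ 2 := by positivity
  have := mul_le_mul_of_nonneg_left (hcz x hx) (hp0 x hx)
  rw [Real.norm_of_nonneg (hp0 x hx), inv_mul_eq_div, le_div_iff₀ h1]
  exact this

/-- A solution moving away from zero at `x₀` and of finite potential energy near the right endpoint
vanishes at `x₀`. -/
theorem eq_zero_of_mul_deriv_nonneg {b x₀ : ℝ} (hx₀ : x₀ < b) {p ρ z z' : ℝ → ℝ}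
    (hρ : ∀ x ∈ Ico x₀ b, 0 ≤ ρ x) (hz : ∀ x ∈ Ico x₀ b, HasDerivAt z (z' x) x)
    (hz' : ∀ x ∈ Ico x₀ b, HasDerivAt z' (ρ x * z x) x)
    (hp : ContinuousOn p (Ioo x₀ b)) (hp0 : ∀ x ∈ Ioo x₀ b, 0 ≤ p x)
    (hpz : IntegrableOn (fun x => p x * z x ^ 2) (Ioo x₀ b)) (hpi : ¬ IntegrableOn p (Ioo x₀ b))
    (h0 : 0 ≤ z x₀ * z' x₀) : z x₀ = 0 := by
  by_contra hne
  refine hpi (integrableOn_of_mul_sq measurableSet_Ioo hp hp0 hpz hne fun x hx => ?_)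
  have hmem : x₀ ∈ Ico x₀ b := ⟨le_rfl, hx₀⟩
  have hm := monotoneOn_mul_deriv (convex_Ico x₀ b) hρ hz hz'
  have hd : ∀ y ∈ Ico x₀ b, HasDerivAt (fun x => z x ^ 2) (2 * z y * z' y) y :=
    fun y hy => ((hz y hy).pow 2).congr_deriv (by ring)
  have : MonotoneOn (fun x => z x ^ 2) (Ico x₀ b) := by
    refine monotoneOn_of_deriv_nonneg (convex_Ico x₀ b)
      (fun y hy => (hd y hy).continuousAt.continuousWithinAt)
      (fun y hy => (hd y (interior_subset hy)).differentiableAt.differentiableWithinAt)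
      fun y hy => ?_
    rw [(hd y (interior_subset hy)).deriv]
    have := h0.trans (hm hmem (interior_subset hy) (interior_subset hy).1)
    simp only at this
    linarith
  exact this hmem ⟨hx.1.le, hx.2⟩ hx.1.le

/-- A solution moving towards zero at `x₀` and of finite potential energy near the left endpoint
vanishes at `x₀`. -/
theorem eq_zero_of_mul_deriv_nonpos {a x₀ : ℝ} (hx₀ : a < x₀) {p ρ z z' : ℝ → ℝ}
    (hρ : ∀ x ∈ Ioc a x₀, 0 ≤ ρ x) (hz : ∀ x ∈ Ioc a x₀, HasDerivAt z (z' x) x)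
    (hz' : ∀ x ∈ Ioc a x₀, HasDerivAt z' (ρ x * z x) x)
    (hp : ContinuousOn p (Ioo a x₀)) (hp0 : ∀ x ∈ Ioo a x₀, 0 ≤ p x)
    (hpz : IntegrableOn (fun x => p x * z x ^ 2) (Ioo a x₀)) (hpi : ¬ IntegrableOn p (Ioo a x₀))
    (h0 : z x₀ * z' x₀ ≤ 0) : z x₀ = 0 := by
  by_contra hne
  refine hpi (integrableOn_of_mul_sq measurableSet_Ioo hp hp0 hpz hne fun x hx => ?_)
  have hmem : x₀ ∈ Ioc a x₀ := ⟨hx₀, le_rfl⟩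
  have hm := monotoneOn_mul_deriv (convex_Ioc a x₀) hρ hz hz'
  have hd : ∀ y ∈ Ioc a x₀, HasDerivAt (fun x => z x ^ 2) (2 * z y * z' y) y :=
    fun y hy => ((hz y hy).pow 2).congr_deriv (by ring)
  have : AntitoneOn (fun x => z x ^ 2) (Ioc a x₀) := by
    refine antitoneOn_of_deriv_nonpos (convex_Ioc a x₀)
      (fun y hy => (hd y hy).continuousAt.continuousWithinAt)
      (fun y hy => (hd y (interior_subset hy)).differentiableAt.differentiableWithinAt)
      fun y hy => ?_
    rw [(hd y (interior_subset hy)).deriv]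
    have := (hm (interior_subset hy) hmem (interior_subset hy).2).trans h0
    simp only at this
    linarith
  exact this ⟨hx.1, hx.2.le⟩ hmem hx.2.le

/-- `φ` solves `φ'' = r φ` on `(a, b)` and its energy with respect to the potential `p` is
finite. -/
structure IsEnergySolution (a b : ℝ) (p r φ φ' : ℝ → ℝ) : Prop where
  hasDerivAt : ∀ x ∈ Ioo a b, HasDerivAt φ (φ' x) x
  hasDerivAt_deriv : ∀ x ∈ Ioo a b, HasDerivAt φ' (r x * φ x) x
  energy : IntegrableOn (fun x => φ' x ^ 2 + p x * φ x ^ 2) (Ioo a b)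

theorem integrableOn_mul_sq_of_energy {a b : ℝ} {p φ φ' : ℝ → ℝ} (hp : ContinuousOn p (Ioo a b))
    (hp0 : ∀ x ∈ Ioo a b, 0 ≤ p x) (hφ : ContinuousOn φ (Ioo a b))
    (h : IntegrableOn (fun x => φ' x ^ 2 + p x * φ x ^ 2) (Ioo a b)) :
    IntegrableOn (fun x => p x * φ x ^ 2) (Ioo a b) := by
  refine Integrable.mono' h ((hp.mul (hφ.pow 2)).aestronglyMeasurable measurableSet_Ioo)
    ((ae_restrict_iff' measurableSet_Ioo).2 (Eventually.of_forall fun x hx => ?_))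
  have := hp0 x hx
  rw [Real.norm_of_nonneg (by positivity)]
  exact le_add_of_nonneg_left (sq_nonneg _)

theorem integrableOn_mul_sub_sq {a b c : ℝ} {p φ ψ : ℝ → ℝ} (hp : ContinuousOn p (Ioo a b))
    (hp0 : ∀ x ∈ Ioo a b, 0 ≤ p x) (hφ : ContinuousOn φ (Ioo a b)) (hψ : ContinuousOn ψ (Ioo a b))
    (h : IntegrableOn (fun x => p x * φ x ^ 2) (Ioo a b))
    (h' : IntegrableOn (fun x => p x * ψ x ^ 2) (Ioo a b)) :
    IntegrableOn (fun x => p x * (φ x - c * ψ x) ^ 2) (Ioo a b) := by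
  refine Integrable.mono' ((h.const_mul 2).add (h'.const_mul (2 * c ^ 2)))
    ((hp.mul ((hφ.sub (continuousOn_const.mul hψ)).pow 2)).aestronglyMeasurable measurableSet_Ioo)
    ((ae_restrict_iff' measurableSet_Ioo).2 (Eventually.of_forall fun x hx => ?_))
  have := hp0 x hx
  rw [Real.norm_of_nonneg (by positivity)]
  simp only [Pi.add_apply]
  nlinarith [mul_nonneg this (sq_nonneg (φ x + c * ψ x))]

namespace IsEnergySolution

variable {a b : ℝ} {p r φ φ' ψ ψ' : ℝ → ℝ}

theorem continuousOn (h : IsEnergySolution a b p r φ φ') : ContinuousOn φ (Ioo a b) :=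
  fun x hx => (h.hasDerivAt x hx).continuousAt.continuousWithinAt

/-- Near an endpoint where the potential blows up there is, up to scaling, at most one solution of
finite energy. -/
theorem exists_eq_const_mul (h : IsEnergySolution a b p r φ φ') (h' : IsEnergySolution a b p r ψ ψ')
    (hp : ContinuousOn p (Ioo a b)) (hp0 : ∀ x ∈ Ioo a b, 0 ≤ p x)
    (hpi : ∀ c ∈ Ioo a b, ¬ IntegrableOn p (Ioo c b)) (hr : ContinuousOn r (Ioo a b))
    (hrb : ∃ c ∈ Ioo a b, ∀ x ∈ Ioo c b, 0 ≤ r x) (hφ : ∃ x ∈ Ioo a b, φ x ≠ 0) :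
    ∃ c, ∀ x ∈ Ioo a b, ψ x = c * φ x := by
  obtain ⟨d, hd, hrd⟩ := hrb
  have hsub : Ioo d b ⊆ Ioo a b := Ioo_subset_Ioo_left hd.1.le
  have hunique : ∀ {z z' : ℝ → ℝ}, (∀ x ∈ Ioo a b, HasDerivAt z (z' x) x) →
      (∀ x ∈ Ioo a b, HasDerivAt z' (r x * z x) x) → ∀ e ∈ Ioo a b, (∀ x ∈ Ioo e b, z x = 0) →
      ∀ x ∈ Ioo a b, z x = 0 := by
    intro z z' hz hz' e he h0
    obtain ⟨m, hm⟩ := exists_between he.2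
    have hm' : m ∈ Ioo a b := ⟨he.1.trans hm.1, hm.2⟩
    refine eqOn_zero_of_linear_ode hr hz hz' hm' (h0 m hm) ?_
    refine (hz m hm').unique ((hasDerivAt_const m (0 : ℝ)).congr_of_eventuallyEq ?_)
    filter_upwards [isOpen_Ioo.mem_nhds hm] with y hy using h0 y hy
  obtain ⟨x₀, hx₀, hne⟩ : ∃ x ∈ Ioo d b, φ x ≠ 0 := by
    by_contra! hcon
    obtain ⟨x, hx, hne⟩ := hφ
    exact hne (hunique h.hasDerivAt h.hasDerivAt_deriv d hd hcon x hx)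
  set c := ψ x₀ / φ x₀ with hc
  refine ⟨c, ?_⟩
  set z : ℝ → ℝ := fun x => ψ x - c * φ x with hz
  set z' : ℝ → ℝ := fun x => ψ' x - c * φ' x with hz'
  have hzd : ∀ x ∈ Ioo a b, HasDerivAt z (z' x) x := fun x hx =>
    (h'.hasDerivAt x hx).sub ((h.hasDerivAt x hx).const_mul c)
  have hzd' : ∀ x ∈ Ioo a b, HasDerivAt z' (r x * z x) x := fun x hx =>
    ((h'.hasDerivAt_deriv x hx).sub ((h.hasDerivAt_deriv x hx).const_mul c)).congr_deriv
      (by simp only [hz]; ring)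
  have hpz : IntegrableOn (fun x => p x * z x ^ 2) (Ioo a b) :=
    integrableOn_mul_sub_sq hp hp0 h'.continuousOn h.continuousOn
      (integrableOn_mul_sq_of_energy hp hp0 h'.continuousOn h'.energy)
      (integrableOn_mul_sq_of_energy hp hp0 h.continuousOn h.energy)
  have hz0 : z x₀ = 0 := by simp only [hz, hc]; field_simp; ring
  have hIco : ∀ y ∈ Ico x₀ b, y ∈ Ioo d b := fun y hy => ⟨hx₀.1.trans_le hy.1, hy.2⟩
  have hm := monotoneOn_mul_deriv (convex_Ico x₀ b) (fun y hy => hrd y (hIco y hy))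
    (fun y hy => hzd y (hsub (hIco y hy))) (fun y hy => hzd' y (hsub (hIco y hy)))
  have hzero : ∀ x ∈ Ioo a b, z x = 0 := by
    refine hunique hzd hzd' x₀ (hsub hx₀) fun y hy => ?_
    have hyd : y ∈ Ioo d b := ⟨hx₀.1.trans hy.1, hy.2⟩
    have hy' := hsub hyd
    have hsy : Ioo y b ⊆ Ioo a b := Ioo_subset_Ioo_left hy'.1.le
    have hIcy : ∀ w ∈ Ico y b, w ∈ Ioo d b := fun w hw => ⟨hyd.1.trans_le hw.1, hw.2⟩
    refine eq_zero_of_mul_deriv_nonneg hy.2 (fun w hw => hrd w (hIcy w hw))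
      (fun w hw => hzd w (hsub (hIcy w hw))) (fun w hw => hzd' w (hsub (hIcy w hw)))
      (hp.mono hsy) (fun w hw => hp0 w (hsy hw)) (hpz.mono_set hsy) (hpi y hy') ?_
    have := hm ⟨le_rfl, hx₀.2⟩ ⟨hy.1.le, hy.2⟩ hy.1.le
    simpa [hz0] using this
  intro x hx
  exact sub_eq_zero.1 (hzero x hx)

/-- If the potential is not integrable at either endpoint, the only solution of `z'' = p z` of
finite energy is zero. -/
theorem eq_zero_of_not_integrableOn {z z' : ℝ → ℝ}
    (hz : ∀ x ∈ Ioo a b, HasDerivAt z (z' x) x) (hz' : ∀ x ∈ Ioo a b, HasDerivAt z' (p x * z x) x)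
    (hp : ContinuousOn p (Ioo a b)) (hp0 : ∀ x ∈ Ioo a b, 0 ≤ p x)
    (hpa : ∀ c ∈ Ioo a b, ¬ IntegrableOn p (Ioo a c))
    (hpb : ∀ c ∈ Ioo a b, ¬ IntegrableOn p (Ioo c b))
    (hpz : IntegrableOn (fun x => p x * z x ^ 2) (Ioo a b)) : ∀ x ∈ Ioo a b, z x = 0 := by
  intro x hx
  rcases le_total 0 (z x * z' x) with h0 | h0
  · have h1 : Ico x b ⊆ Ioo a b := fun y hy => ⟨hx.1.trans_le hy.1, hy.2⟩
    have h2 : Ioo x b ⊆ Ioo a b := Ioo_subset_Ico_self.trans h1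
    exact eq_zero_of_mul_deriv_nonneg hx.2 (fun y hy => hp0 y (h1 hy)) (fun y hy => hz y (h1 hy))
      (fun y hy => hz' y (h1 hy)) (hp.mono h2) (fun y hy => hp0 y (h2 hy)) (hpz.mono_set h2)
      (hpb x hx) h0
  · have h1 : Ioc a x ⊆ Ioo a b := fun y hy => ⟨hy.1, hy.2.trans_lt hx.2⟩
    have h2 : Ioo a x ⊆ Ioo a b := Ioo_subset_Ioc_self.trans h1
    exact eq_zero_of_mul_deriv_nonpos hx.1 (fun y hy => hp0 y (h1 hy)) (fun y hy => hz y (h1 hy))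
      (fun y hy => hz' y (h1 hy)) (hp.mono h2) (fun y hy => hp0 y (h2 hy)) (hpz.mono_set h2)
      (hpa x hx) h0

end IsEnergySolution

theorem backwardOp_congr {a b : ℝ} {u h h' : ℝ → ℝ} (hh : h =ᵐ[volume.restrict (Ioo a b)] h')
    {x : ℝ} (hx : x ∈ Ioo a b) : backwardOp b u h x = backwardOp b u h' x := by
  rw [backwardOp, backwardOp]
  congr 1
  refine integral_congr_ae ?_
  filter_upwards [ae_restrict_of_ae_restrict_of_subset (Ioo_subset_Ioo_left hx.1.le) hh] with y hy
  rw [hy]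

theorem forwardOp_congr {a b : ℝ} {u h h' : ℝ → ℝ} (hh : h =ᵐ[volume.restrict (Ioo a b)] h')
    {x : ℝ} (hx : x ∈ Ioo a b) : forwardOp a u h x = forwardOp a u h' x := by
  rw [forwardOp, forwardOp]
  congr 1
  refine integral_congr_ae ?_
  filter_upwards [ae_restrict_of_ae_restrict_of_subset (Ioo_subset_Ioo_right hx.2.le) hh] with y hy
  rw [hy]

namespace IsIncreasingSolution

variable {a b : ℝ} {u u' p : ℝ → ℝ} (S : IsIncreasingSolution a b u u' p)
include S

theorem exists_compact_backwardOp :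
    ∃ K : Lp ℝ 2 (volume.restrict (Ioo a b)) →L[ℝ] Lp ℝ 2 (volume.restrict (Ioo a b)),
      IsCompactOperator K ∧
      (∀ h, K h =ᵐ[volume.restrict (Ioo a b)] backwardOp b u h) ∧
      ∀ h, K.adjoint h =ᵐ[volume.restrict (Ioo a b)] forwardOp a u h := by
  have hu : AEStronglyMeasurable u (volume.restrict (Ioo a b)) :=
    S.continuousOn.aestronglyMeasurable measurableSet_Ioo
  have hui : AEStronglyMeasurable (fun y => (u y)⁻¹) (volume.restrict (Ioo a b)) :=
    (S.continuousOn.inv₀ fun x hx => S.ne_zero hx).aestronglyMeasurable measurableSet_Ioo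
  set k : ℝ → ℝ → ℝ := fun x y => (Ioi x).indicator (fun y => u x * (u y)⁻¹) y with hk
  have hkm : AEStronglyMeasurable (Function.uncurry k)
      ((volume.restrict (Ioo a b)).prod (volume.restrict (Ioo a b))) := by
    have : Function.uncurry k = {z : ℝ × ℝ | z.1 < z.2}.indicator fun z => u z.1 * (u z.2)⁻¹ := by
      funext z
      simp only [hk, Function.uncurry, indicator_apply, mem_Ioi, mem_ofPred_eq]
    rw [this]
    exact (hu.comp_fst.mul hui.comp_snd).indicator (measurableSet_lt measurable_fst measurable_snd)
  have hkb : ∀ x ∈ Ioo a b, ∀ y ∈ Ioo a b, |k x y| ≤ 1 := by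
    intro x hx y hy
    simp only [hk, indicator_apply, mem_Ioi]
    split_ifs with h
    · have hux := S.pos x hx
      have huy := S.pos y hy
      rw [abs_of_pos (by positivity), ← div_eq_mul_inv, div_le_one huy]
      exact S.monotoneOn hx hy h.le
    · simp
  have hkx : ∀ x ∈ Ioo a b, AEStronglyMeasurable (k x) (volume.restrict (Ioo a b)) := by
    exact fun x _ => (hui.const_mul (u x)).indicator measurableSet_Ioi
  have hkc : ∀ x₀ ∈ Ioo a b, ∀ᵐ y ∂(volume.restrict (Ioo a b)),
      ContinuousWithinAt (fun x => k x y) (Ioo a b) x₀ := by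
    intro x₀ hx₀
    have hne : ∀ᵐ y ∂(volume.restrict (Ioo a b)), y ≠ x₀ :=
      ae_restrict_of_ae (by simp [ae_iff, measure_singleton])
    filter_upwards [hne] with y hy
    rcases lt_or_gt_of_ne hy with h | h
    · refine ContinuousAt.continuousWithinAt ?_
      refine (continuousAt_const (y := (0 : ℝ))).congr ?_
      filter_upwards [lt_mem_nhds h] with x hx
      simp [hk, indicator_apply, not_lt.2 hx.le]
    · refine ContinuousAt.continuousWithinAt ?_
      refine ((S.hasDerivAt x₀ hx₀).continuousAt.mul
        (continuousAt_const (y := (u y)⁻¹))).congr ?_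
      filter_upwards [gt_mem_nhds h] with x hx
      simp [hk, indicator_apply, hx]
  obtain ⟨K, hK, h1, h2⟩ := exists_compact_integral_operator (s := Ioo a b) measurableSet_Ioo
    (k := k) (C := 1) hkm hkb hkx hkc
  refine ⟨K, hK, fun h => ?_, fun h => ?_⟩
  · filter_upwards [h1 h, ae_restrict_mem measurableSet_Ioo] with x hx hxI
    rw [hx, backwardOp, ← integral_const_mul]
    have : (fun y => k x y * h y) = (Ioi x).indicator fun y => u x * (h y / u y) := by
      funext y
      simp only [hk, indicator_apply]
      split_ifs
      · ring
      · simp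
    rw [this, setIntegral_indicator measurableSet_Ioi, Ioo_inter_Ioi, max_eq_right hxI.1.le]
  · filter_upwards [h2 h, ae_restrict_mem measurableSet_Ioo] with y hy hyI
    rw [hy, forwardOp, ← integral_div]
    have : (fun x => k x y * h x) = (Iio y).indicator fun x => u x * h x / u y := by
      funext x
      simp only [hk, indicator_apply, mem_Ioi, mem_Iio]
      split_ifs
      · ring
      · simp
    rw [this, setIntegral_indicator measurableSet_Iio, Ioo_inter_Iio, min_eq_right hyI.2.le]

theorem ae_eq_zero_of_forwardOp {h : ℝ → ℝ} (hi : IntegrableOn h (Ioo a b))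
    (h0 : forwardOp a u h =ᵐ[volume.restrict (Ioo a b)] 0) :
    h =ᵐ[volume.restrict (Ioo a b)] 0 := by
  have h1 := Measure.eqOn_open_of_ae_eq h0 isOpen_Ioo (S.continuousOn_forwardOp hi)
    continuousOn_const
  have h2 : ∀ y ∈ Ioo a b, ∫ x in a..y, u x * h x = 0 := by
    intro y hy
    have := h1 hy
    rw [forwardOp, Pi.zero_apply, div_eq_zero_iff] at this
    rw [intervalIntegral.integral_of_le hy.1.le, integral_Ioc_eq_integral_Ioo]
    exact this.resolve_right (S.ne_zero hy)
  have h3 : ∀ᵐ x, ∀ d : ℚ, (d : ℝ) ∈ Ioo a b → x ∈ uIcc a (d : ℝ) →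
      ∀ c ∈ uIcc a (d : ℝ), HasDerivAt (fun x => ∫ t in c..x, u t * h t) (u x * h x) x := by
    refine ae_all_iff.2 fun d => ?_
    by_cases hd : (d : ℝ) ∈ Ioo a b
    · have hii : IntervalIntegrable (fun t => u t * h t) volume a d :=
        (intervalIntegrable_iff_integrableOn_Ioo_of_le hd.1.le).2 (S.integrableOn_mul hi hd)
      filter_upwards [hii.ae_hasDerivAt_integral] with x hx _ using hx
    · exact Eventually.of_forall fun x h => absurd h hd
  filter_upwards [ae_restrict_of_ae h3, ae_restrict_mem measurableSet_Ioo] with x hx hxI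
  obtain ⟨d, hxd, hdb⟩ := exists_rat_btwn hxI.2
  have had : a < d := hxI.1.trans hxd
  have hder := hx d ⟨had, hdb⟩ (by rw [uIcc_of_le had.le]; exact ⟨hxI.1.le, hxd.le⟩) a
    left_mem_uIcc
  have hder0 : HasDerivAt (fun x => ∫ t in a..x, u t * h t) 0 x := by
    refine (hasDerivAt_const x (0 : ℝ)).congr_of_eventuallyEq ?_
    filter_upwards [isOpen_Ioo.mem_nhds hxI] with y hy using h2 y hy
  exact (mul_eq_zero.1 (hder.unique hder0)).resolve_left (S.ne_zero hxI)

end IsIncreasingSolution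

theorem exists_mulOperator {α : Type*} [MeasurableSpace α] {μ : Measure α} {w : α → ℝ}
    (hw : AEStronglyMeasurable w μ) {C : ℝ} (hC : ∀ᵐ x ∂μ, ‖w x‖ ≤ C) :
    ∃ W : Lp ℝ 2 μ →L[ℝ] Lp ℝ 2 μ, ∀ h, W h =ᵐ[μ] fun x => w x * h x := by
  have hm : MemLp w ⊤ μ := memLp_top_of_bound hw C hC
  refine ⟨(ContinuousLinearMap.mul ℝ ℝ).holderL μ ⊤ 2 2 (hm.toLp w), fun h => ?_⟩
  filter_upwards [(ContinuousLinearMap.mul ℝ ℝ).coeFn_holder (r := 2) (hm.toLp w) h,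
    hm.coeFn_toLp] with x h1 h2
  rw [h2] at h1
  exact h1

theorem not_finiteDimensional_Lp_Ioo {a b : ℝ} (hab : a < b) :
    ¬ FiniteDimensional ℝ (Lp ℝ 2 (volume.restrict (Ioo a b))) := by
  intro hfd
  obtain ⟨v, hv, hvI, -⟩ := exists_seq_strictMono_tendsto' hab
  set s : ℕ → Set ℝ := fun n => Ioo (v n) (v (n + 1)) with hs
  have hsm : ∀ n, MeasurableSet (s n) := fun n => measurableSet_Ioo
  set f : ℕ → Lp ℝ 2 (volume.restrict (Ioo a b)) := fun n =>
    indicatorConstLp 2 (hsm n) (measure_ne_top _ _) 1 with hf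
  have hinner : ∀ m n, inner ℝ (f m) (f n) = (volume.restrict (Ioo a b)).real (s m ∩ s n) :=
    fun m n => L2.real_inner_indicatorConstLp_one_indicatorConstLp_one (hsm m) (hsm n)
  have hne : ∀ n, f n ≠ 0 := by
    intro n h0
    have h1 := hinner n n
    have hsub : s n ⊆ Ioo a b := fun y hy =>
      ⟨(hvI n).1.trans hy.1, hy.2.trans (hvI (n + 1)).2⟩
    rw [h0, inner_zero_left, inter_self, measureReal_def, Measure.restrict_apply (hsm n),
      inter_eq_left.2 hsub, Real.volume_Ioo, ENNReal.toReal_ofReal] at h1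
    · linarith [hv (Nat.lt_succ_self n)]
    · linarith [hv (Nat.lt_succ_self n)]
  have hpair : Pairwise fun m n => inner ℝ (f m) (f n) = 0 := by
    intro m n hmn
    have hdisj : s m ∩ s n = ∅ := by
      refine eq_empty_of_forall_notMem fun y hy => ?_
      rcases lt_or_gt_of_ne hmn with h | h
      · exact absurd (hy.1.2.trans_le (hv.monotone h)) (not_lt.2 hy.2.1.le)
      · exact absurd (hy.2.2.trans_le (hv.monotone h)) (not_lt.2 hy.1.1.le)
    rw [hinner, hdisj]
    simp
  have hli : LinearIndependent ℝ f := linearIndependent_of_ne_zero_of_inner_eq_zero hne hpair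
  exact not_finite_iff_infinite.2 inferInstance hli.finite_of_isNoetherian

/-- Spectral theorem for `-d²/dx² + p + w` on `(a, b)`, realised through solutions of finite energy,
for a potential `p` that admits an increasing zero-energy solution and is singular at both ends. -/
theorem IsIncreasingSolution.exists_energy_eigenbasis {a b : ℝ} {u u' p : ℝ → ℝ}
    (S : IsIncreasingSolution a b u u' p)
    (hpa : ∀ c ∈ Ioo a b, ¬ IntegrableOn p (Ioo a c))
    (hpb : ∀ c ∈ Ioo a b, ¬ IntegrableOn p (Ioo c b))
    (hpt : Tendsto p (nhdsWithin b (Iio b)) atTop) {w : ℝ → ℝ}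
    (hw : ContinuousOn w (Ioo a b)) (hw0 : ∀ x ∈ Ioo a b, 0 ≤ w x) {C : ℝ}
    (hwC : ∀ x ∈ Ioo a b, w x ≤ C) :
    ∃ (κ : ℕ → ℝ) (φ φ' : ℕ → ℝ → ℝ), StrictMono κ ∧ Tendsto κ atTop atTop ∧
      (∀ n, IsEnergySolution a b p (fun x => p x + w x - κ n) (φ n) (φ' n)) ∧
      (∀ n, IntegrableOn (fun x => φ n x ^ 2) (Ioo a b)) ∧
      (∀ m n, ∫ x in Ioo a b, φ m x * φ n x = if m = n then 1 else 0) ∧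
      (∀ g : ℝ → ℝ, MemLp g 2 (volume.restrict (Ioo a b)) →
        (∀ n, ∫ x in Ioo a b, g x * φ n x = 0) → g =ᵐ[volume.restrict (Ioo a b)] 0) ∧
      ∀ (μ : ℝ) (η η' : ℝ → ℝ), IsEnergySolution a b p (fun x => p x + w x - μ) η η' →
        IntegrableOn (fun x => η x ^ 2) (Ioo a b) →
        (∃ n c, μ = κ n ∧ ∀ x ∈ Ioo a b, η x = c * φ n x) ∨ ∀ x ∈ Ioo a b, η x = 0 := by
  set ν := volume.restrict (Ioo a b) with hν
  obtain ⟨K, hKc, hK, hKadj⟩ := S.exists_compact_backwardOp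
  have hwm : AEStronglyMeasurable w ν := hw.aestronglyMeasurable measurableSet_Ioo
  have hwb : ∀ᵐ x ∂ν, ‖w x‖ ≤ C := (ae_restrict_iff' measurableSet_Ioo).2
    (Eventually.of_forall fun x hx => by rw [Real.norm_of_nonneg (hw0 x hx)]; exact hwC x hx)
  obtain ⟨W, hW⟩ := exists_mulOperator hwm hwb
  have hLpi : ∀ h : Lp ℝ 2 ν, IntegrableOn h (Ioo a b) := fun h =>
    (Lp.memLp h).integrable (by norm_num)
  have hsymm : W.IsSymmetric := fun x y => by
    rw [L2.inner_def, L2.inner_def]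
    refine integral_congr_ae ?_
    filter_upwards [hW x, hW y] with t h1 h2
    simp only [ContinuousLinearMap.coe_coe, h1, h2, RCLike.inner_apply, conj_trivial]
    ring
  have hWpos : ∀ x, 0 ≤ inner ℝ (W x) x := fun x => by
    rw [L2.inner_def]
    refine integral_nonneg_of_ae ?_
    filter_upwards [hW x, ae_restrict_mem measurableSet_Ioo] with t h1 ht
    simp only [h1, RCLike.inner_apply, conj_trivial, Pi.zero_apply]
    have := mul_nonneg (hw0 t ht) (mul_self_nonneg (x t))
    linarith
  have hKinj : ∀ x, K.adjoint x = 0 → x = 0 := fun x hx => by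
    refine Lp.ext ?_
    have h1 : forwardOp a u x =ᵐ[ν] 0 := by
      refine (hKadj x).symm.trans ?_
      rw [hx]
      exact Lp.coeFn_zero ℝ 2 ν
    exact (S.ae_eq_zero_of_forwardOp (hLpi x) h1).trans (Lp.coeFn_zero ℝ 2 ν).symm
  have hKK : ∀ h : Lp ℝ 2 ν, K (K.adjoint h) =ᵐ[ν] backwardOp b u (forwardOp a u h) := fun h => by
    filter_upwards [hK (K.adjoint h), ae_restrict_mem measurableSet_Ioo] with x hx hxI
    rw [hx]
    exact backwardOp_congr (hKadj h) hxI
  have hsub : ∀ (μ : ℝ) (h : Lp ℝ 2 ν),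
      (μ • h - W h : Lp ℝ 2 ν) =ᵐ[ν] fun x => (μ - w x) * h x := fun μ h => by
    filter_upwards [Lp.coeFn_sub (μ • h) (W h), Lp.coeFn_smul μ h, hW h] with x h1 h2 h3
    rw [h1, Pi.sub_apply, h2, h3, Pi.smul_apply, smul_eq_mul]
    ring
  obtain ⟨T, hTc, hTsymm, hTpos, hT⟩ :=
    exists_resolvent_of_factorization K W hKc hKinj hsymm hWpos
  have hsol : ∀ (μ : ℝ) (x : Lp ℝ 2 ν), μ • T x = x → ∃ φ φ' : ℝ → ℝ,
      IsEnergySolution a b p (fun t => p t + w t - μ) φ φ' ∧ x =ᵐ[ν] φ := by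
    intro μ x hx
    have hx1 := (hT μ x).1 hx
    set g : Lp ℝ 2 ν := μ • x - W x with hg
    set φ := backwardOp b u (forwardOp a u g) with hφ
    have hxφ : x =ᵐ[ν] φ := by
      have := hKK g
      rwa [← hx1] at this
    have hφc : ContinuousOn φ (Ioo a b) := fun t ht =>
      (S.hasDerivAt_backwardOp (S.continuousOn_forwardOp (hLpi g))
        (S.integrableOn_forwardOp (hLpi g)) ht).continuousAt.continuousWithinAt
    set f : ℝ → ℝ := fun t => (μ - w t) * φ t with hf
    have hfc : ContinuousOn f (Ioo a b) := (continuousOn_const.sub hw).mul hφc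
    have hfg : g =ᵐ[ν] f := by
      filter_upwards [hsub μ x, hxφ] with t h1 h2
      rw [h1, h2]
    have hfi : IntegrableOn f (Ioo a b) := (hLpi g).congr hfg
    have hφf : ∀ t ∈ Ioo a b, backwardOp b u (forwardOp a u f) t = φ t := fun t ht =>
      backwardOp_congr ((ae_restrict_iff' measurableSet_Ioo).2
        (Eventually.of_forall fun s hs => forwardOp_congr hfg.symm hs)) ht
    obtain ⟨φ', h1, h2, h3⟩ := S.exists_green hfc hfi
    refine ⟨φ, φ', ⟨fun t ht => ?_, fun t ht => ?_, ?_⟩, hxφ⟩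
    · refine (h1 t ht).congr_of_eventuallyEq ?_
      filter_upwards [isOpen_Ioo.mem_nhds ht] with s hs using (hφf s hs).symm
    · refine (h2 t ht).congr_deriv ?_
      rw [hφf t ht]
      simp only [hf]
      ring
    · exact h3.congr_fun (fun t ht => by simp only [hφf t ht]) measurableSet_Ioo
  have hsol' : ∀ (μ : ℝ) (η η' : ℝ → ℝ), IsEnergySolution a b p (fun t => p t + w t - μ) η η' →
      ∀ hη : MemLp η 2 ν, μ • T (hη.toLp η) = hη.toLp η := by
    intro μ η η' h hη
    set x := hη.toLp η with hx
    have hxη : x =ᵐ[ν] η := hη.coeFn_toLp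
    set f : ℝ → ℝ := fun t => (μ - w t) * η t with hf
    have hfc : ContinuousOn f (Ioo a b) := (continuousOn_const.sub hw).mul h.continuousOn
    have hfg : (μ • x - W x : Lp ℝ 2 ν) =ᵐ[ν] f := by
      filter_upwards [hsub μ x, hxη] with t h1 h2
      rw [h1, h2]
    have hfi : IntegrableOn f (Ioo a b) := (hLpi _).congr hfg
    obtain ⟨φ', h1, h2, h3⟩ := S.exists_green hfc hfi
    set φ := backwardOp b u (forwardOp a u f) with hφ
    have hφc : ContinuousOn φ (Ioo a b) := fun t ht => (h1 t ht).continuousAt.continuousWithinAt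
    have hz : ∀ t ∈ Ioo a b, η t - 1 * φ t = 0 := by
      refine IsEnergySolution.eq_zero_of_not_integrableOn (z' := fun t => η' t - 1 * φ' t)
        (fun t ht => (h.hasDerivAt t ht).sub ((h1 t ht).const_mul 1))
        (fun t ht => ((h.hasDerivAt_deriv t ht).sub ((h2 t ht).const_mul 1)).congr_deriv ?_)
        S.potential_continuousOn S.potential_nonneg hpa hpb ?_
      · simp only [hf]
        ring
      · exact integrableOn_mul_sub_sq S.potential_continuousOn S.potential_nonneg h.continuousOn hφc
          (integrableOn_mul_sq_of_energy S.potential_continuousOn S.potential_nonneg h.continuousOn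
            h.energy)
          (integrableOn_mul_sq_of_energy S.potential_continuousOn S.potential_nonneg hφc h3)
    refine (hT μ x).2 (Lp.ext ?_)
    filter_upwards [hxη, hKK (μ • x - W x), ae_restrict_mem measurableSet_Ioo] with t ht1 ht2 ht
    rw [ht1, ht2, sub_eq_zero.1 (hz t ht), one_mul]
    exact backwardOp_congr ((ae_restrict_iff' measurableSet_Ioo).2
        (Eventually.of_forall fun s hs => forwardOp_congr hfg.symm hs)) ht
  have hne_zero : ∀ (x : Lp ℝ 2 ν) (φ : ℝ → ℝ), x =ᵐ[ν] φ → x ≠ 0 → ∃ t ∈ Ioo a b, φ t ≠ 0 := by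
    intro x φ hxφ hx
    by_contra! hcon
    refine hx (Lp.ext ?_)
    filter_upwards [hxφ, Lp.coeFn_zero ℝ 2 ν, ae_restrict_mem measurableSet_Ioo] with t h1 h2 ht
    rw [h1, h2, hcon t ht]
    rfl
  have hrb : ∀ μ : ℝ, ∃ c ∈ Ioo a b, ∀ t ∈ Ioo c b, 0 ≤ p t + w t - μ := by
    intro μ
    have h1 := (hpt.eventually_ge_atTop μ).and (Ioo_mem_nhdsLT S.lt)
    obtain ⟨c, hc, hcp⟩ := (mem_nhdsLT_iff_exists_Ioo_subset' S.lt).1 h1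
    obtain ⟨d, hd⟩ := exists_between (max_lt S.lt hc)
    rw [max_lt_iff] at hd
    refine ⟨d, ⟨hd.1.1, hd.2⟩, fun t ht => ?_⟩
    have h2 := hcp (show t ∈ Ioo c b from ⟨hd.1.2.trans ht.1, ht.2⟩)
    have h3 := hw0 t h2.2
    linarith [h2.1]
  obtain ⟨κ, e, hκ, hκt, he, heo, hec, hes⟩ := exists_eigenbasis_of_compact
    (not_finiteDimensional_Lp_Ioo S.lt) T hTc hTsymm hTpos (by
      intro μ x y hx0 hx hy
      obtain ⟨φ, φ', hφ, hxφ⟩ := hsol μ x hx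
      obtain ⟨ψ, ψ', hψ, hyψ⟩ := hsol μ y hy
      obtain ⟨c, hc⟩ := hφ.exists_eq_const_mul hψ S.potential_continuousOn S.potential_nonneg hpb
        ((S.potential_continuousOn.add hw).sub continuousOn_const) (hrb μ)
        (hne_zero x φ hxφ hx0)
      refine ⟨c, Lp.ext ?_⟩
      filter_upwards [hxφ, hyψ, Lp.coeFn_smul c x, ae_restrict_mem measurableSet_Ioo]
        with t h1 h2 h3 ht
      rw [h2, h3, Pi.smul_apply, h1, smul_eq_mul, hc t ht])
  choose φ φ' hφ heφ using fun n => hsol (κ n) (e n) (he n)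
  have hφm : ∀ n, MemLp (φ n) 2 ν := fun n => (memLp_congr_ae (heφ n)).1 (Lp.memLp (e n))
  refine ⟨κ, φ, φ', hκ, hκt, hφ, fun n => (hφm n).integrable_sq, fun m n => ?_,
    fun g hg hgn => ?_, fun μ η η' hη hη2 => ?_⟩
  · rw [← orthonormal_iff_ite.1 heo m n, L2.inner_def]
    refine integral_congr_ae ?_
    filter_upwards [heφ m, heφ n] with t h1 h2
    rw [h1, h2, RCLike.inner_apply, conj_trivial, mul_comm]
  · have h0 := hec (hg.toLp g) fun n => by
      rw [← hgn n, L2.inner_def]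
      refine integral_congr_ae ?_
      filter_upwards [heφ n, hg.coeFn_toLp] with t h1 h2
      rw [h1, h2, RCLike.inner_apply, conj_trivial, mul_comm]
    have h1 := hg.coeFn_toLp
    rw [h0] at h1
    exact h1.symm.trans (Lp.coeFn_zero ℝ 2 ν)
  · have hηm : MemLp η 2 ν := (memLp_two_iff_integrable_sq
      (hη.continuousOn.aestronglyMeasurable measurableSet_Ioo)).2 hη2
    have hx := hsol' μ η η' hη hηm
    by_cases hx0 : hηm.toLp η = 0
    · right
      have h1 := hηm.coeFn_toLp
      rw [hx0] at h1
      exact Measure.eqOn_open_of_ae_eq (h1.symm.trans (Lp.coeFn_zero ℝ 2 ν)) isOpen_Ioo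
        hη.continuousOn continuousOn_const
    · left
      obtain ⟨n, c, hμ, hc⟩ := hes μ _ hx0 hx
      refine ⟨n, c, hμ, Measure.eqOn_open_of_ae_eq (μ := volume) ?_ isOpen_Ioo hη.continuousOn
        (continuousOn_const.mul (hφ n).continuousOn)⟩
      have h1 := hηm.coeFn_toLp
      rw [hc] at h1
      filter_upwards [h1, Lp.coeFn_smul c (e n), heφ n] with t h1 h2 h3
      rw [← h1, h2, Pi.smul_apply, h3, smul_eq_mul]

/-- The singular part of the Liouville potential. -/
noncomputable def modelPotential (k ξ : ℝ) : ℝ :=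
  ((1 + sin ξ)⁻¹ - 1 / 2) + (k / 2 + k ^ 2) * (2 * (1 - sin ξ)⁻¹ - 1) + (5 * k - 1) / 2

/-- A positive increasing solution of `u'' = modelPotential k * u`. -/
noncomputable def modelSolution (k ξ : ℝ) : ℝ := (1 + sin ξ) * (1 - sin ξ) ^ (-k)

/-- The logarithmic derivative of `modelSolution`. -/
noncomputable def modelLogDeriv (k ξ : ℝ) : ℝ := cos ξ / (1 + sin ξ) + k * (cos ξ / (1 - sin ξ))

theorem one_add_sin_pos {ξ : ℝ} (hξ : ξ ∈ Ioo (-(π / 2)) (π / 2)) : 0 < 1 + sin ξ := by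
  nlinarith [cos_pos_of_mem_Ioo hξ, sin_sq_add_cos_sq ξ, neg_one_le_sin ξ, sin_le_one ξ]

theorem one_sub_sin_pos {ξ : ℝ} (hξ : ξ ∈ Ioo (-(π / 2)) (π / 2)) : 0 < 1 - sin ξ := by
  nlinarith [cos_pos_of_mem_Ioo hξ, sin_sq_add_cos_sq ξ, neg_one_le_sin ξ, sin_le_one ξ]

theorem half_le_inv_one_add_sin {ξ : ℝ} (hξ : ξ ∈ Ioo (-(π / 2)) (π / 2)) :
    1 / 2 ≤ (1 + sin ξ)⁻¹ := by
  rw [one_div]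
  exact inv_anti₀ (one_add_sin_pos hξ) (by linarith [sin_le_one ξ])

theorem half_le_inv_one_sub_sin {ξ : ℝ} (hξ : ξ ∈ Ioo (-(π / 2)) (π / 2)) :
    1 / 2 ≤ (1 - sin ξ)⁻¹ := by
  rw [one_div]
  exact inv_anti₀ (one_sub_sin_pos hξ) (by linarith [neg_one_le_sin ξ])

theorem hasDerivAt_cos_div_one_add_sin {ξ : ℝ} (hξ : ξ ∈ Ioo (-(π / 2)) (π / 2)) :
    HasDerivAt (fun ξ => cos ξ / (1 + sin ξ)) (-(1 + sin ξ)⁻¹) ξ := by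
  have h := (one_add_sin_pos hξ).ne'
  refine ((hasDerivAt_cos ξ).div ((hasDerivAt_sin ξ).const_add 1) h).congr_deriv ?_
  field_simp
  linarith [sin_sq_add_cos_sq ξ]

theorem hasDerivAt_cos_div_one_sub_sin {ξ : ℝ} (hξ : ξ ∈ Ioo (-(π / 2)) (π / 2)) :
    HasDerivAt (fun ξ => cos ξ / (1 - sin ξ)) (1 - sin ξ)⁻¹ ξ := by
  have h := (one_sub_sin_pos hξ).ne'
  refine ((hasDerivAt_cos ξ).div ((hasDerivAt_sin ξ).const_sub 1) h).congr_deriv ?_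
  field_simp
  linarith [sin_sq_add_cos_sq ξ]

theorem modelPotential_nonneg {k ξ : ℝ} (hk : 1 / 4 < k) (hξ : ξ ∈ Ioo (-(π / 2)) (π / 2)) :
    0 ≤ modelPotential k ξ := by
  have h1 := half_le_inv_one_add_sin hξ
  have h2 := half_le_inv_one_sub_sin hξ
  have h3 : 0 ≤ (k / 2 + k ^ 2) * (2 * (1 - sin ξ)⁻¹ - 1) :=
    mul_nonneg (by positivity) (by linarith)
  rw [modelPotential]
  linarith

open scoped ContDiff in
theorem contDiffOn_modelPotential (k : ℝ) :
    ContDiffOn ℝ ∞ (modelPotential k) (Ioo (-(π / 2)) (π / 2)) := by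
  unfold modelPotential
  have h1 : ContDiffOn ℝ ∞ (fun ξ => (1 + sin ξ)⁻¹) (Ioo (-(π / 2)) (π / 2)) :=
    (contDiff_const.add contDiff_sin).contDiffOn.inv fun ξ hξ => (one_add_sin_pos hξ).ne'
  have h2 : ContDiffOn ℝ ∞ (fun ξ => (1 - sin ξ)⁻¹) (Ioo (-(π / 2)) (π / 2)) :=
    (contDiff_const.sub contDiff_sin).contDiffOn.inv fun ξ hξ => (one_sub_sin_pos hξ).ne'
  exact ((h1.sub contDiffOn_const).add
    (contDiffOn_const.mul ((contDiffOn_const.mul h2).sub contDiffOn_const))).add contDiffOn_const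

theorem isIncreasingSolution_model {k : ℝ} (hk : 1 / 4 < k) :
    IsIncreasingSolution (-(π / 2)) (π / 2) (modelSolution k)
      (fun ξ => modelLogDeriv k ξ * modelSolution k ξ) (modelPotential k) := by
  have hpos : ∀ ξ ∈ Ioo (-(π / 2)) (π / 2), 0 < modelSolution k ξ := fun ξ hξ =>
    mul_pos (one_add_sin_pos hξ) (rpow_pos_of_pos (one_sub_sin_pos hξ) _)
  have hd : ∀ ξ ∈ Ioo (-(π / 2)) (π / 2),
      HasDerivAt (modelSolution k) (modelLogDeriv k ξ * modelSolution k ξ) ξ := fun ξ hξ => by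
    have h1 := one_add_sin_pos hξ
    have h2 := one_sub_sin_pos hξ
    refine (((hasDerivAt_sin ξ).const_add 1).mul (((hasDerivAt_sin ξ).const_sub 1).rpow_const
      (p := -k) (Or.inl h2.ne'))).congr_deriv ?_
    rw [modelLogDeriv, modelSolution, rpow_sub_one h2.ne']
    field_simp
  refine ⟨by linarith [pi_pos], hpos, fun ξ hξ => ?_, fun ξ hξ => modelPotential_nonneg hk hξ,
    (contDiffOn_modelPotential k).continuousOn, hd, fun ξ hξ => ?_⟩
  · have h1 := one_add_sin_pos hξ
    have h2 := one_sub_sin_pos hξ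
    have h3 := cos_pos_of_mem_Ioo hξ
    refine mul_pos ?_ (hpos ξ hξ)
    rw [modelLogDeriv]
    have : 0 < k := by linarith
    positivity
  · have h1 := one_add_sin_pos hξ
    have h2 := one_sub_sin_pos hξ
    refine (((hasDerivAt_cos_div_one_add_sin hξ).add
      ((hasDerivAt_cos_div_one_sub_sin hξ).const_mul k)).mul (hd ξ hξ)).congr_deriv ?_
    have hc : cos ξ ^ 2 = (1 + sin ξ) * (1 - sin ξ) := by nlinarith [sin_sq_add_cos_sq ξ]
    have key : -(1 + sin ξ)⁻¹ + k * (1 - sin ξ)⁻¹ + modelLogDeriv k ξ ^ 2 =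
        modelPotential k ξ := by
      have e : modelLogDeriv k ξ ^ 2 = cos ξ ^ 2 * (1 / (1 + sin ξ) + k / (1 - sin ξ)) ^ 2 := by
        rw [modelLogDeriv]
        ring
      rw [e, hc, modelPotential]
      field_simp
      ring
    rw [← key, modelLogDeriv]
    simp only [Pi.add_apply]
    ring

theorem inv_one_sub_sin_le_modelPotential {k ξ : ℝ} (hk : 1 / 4 < k) (hξ : ξ ∈ Ioo 0 (π / 2)) :
    (1 - sin ξ)⁻¹ ≤ 6 * modelPotential k ξ := by
  have hξ' : ξ ∈ Ioo (-(π / 2)) (π / 2) := ⟨by linarith [hξ.1, pi_pos], hξ.2⟩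
  have h1 := half_le_inv_one_add_sin hξ'
  have h2 : 1 ≤ (1 - sin ξ)⁻¹ := (one_le_inv₀ (one_sub_sin_pos hξ')).2
    (by linarith [sin_pos_of_pos_of_lt_pi hξ.1 (by linarith [hξ.2, pi_pos])])
  have h3 : 1 / 6 ≤ k / 2 + k ^ 2 := by nlinarith
  rw [modelPotential]
  nlinarith [mul_nonneg (sub_nonneg.2 h3) (by linarith : 0 ≤ 2 * (1 - sin ξ)⁻¹ - 1)]

theorem inv_one_add_sin_le_modelPotential {k ξ : ℝ} (hk : 1 / 4 < k)
    (hξ : ξ ∈ Ioo (-(π / 2)) 0) : (1 + sin ξ)⁻¹ ≤ 2 * modelPotential k ξ := by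
  have hξ' : ξ ∈ Ioo (-(π / 2)) (π / 2) := ⟨hξ.1, by linarith [hξ.2, pi_pos]⟩
  have h1 := half_le_inv_one_sub_sin hξ'
  have h2 : 1 ≤ (1 + sin ξ)⁻¹ := (one_le_inv₀ (one_add_sin_pos hξ')).2
    (by linarith [sin_neg_of_neg_of_neg_pi_lt hξ.2 (by linarith [hξ.1, pi_pos])])
  have h3 : 0 ≤ (k / 2 + k ^ 2) * (2 * (1 - sin ξ)⁻¹ - 1) :=
    mul_nonneg (by positivity) (by linarith)
  rw [modelPotential]
  linarith

theorem tendsto_modelPotential {k : ℝ} (hk : 1 / 4 < k) :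
    Tendsto (modelPotential k) (nhdsWithin (π / 2) (Iio (π / 2))) atTop := by
  have hpi := pi_pos
  have hmem : Ioo 0 (π / 2) ∈ nhdsWithin (π / 2) (Iio (π / 2)) := Ioo_mem_nhdsLT (by linarith)
  have h1 : Tendsto (fun ξ => 1 - sin ξ) (nhdsWithin (π / 2) (Iio (π / 2)))
      (nhdsWithin 0 (Ioi 0)) := by
    refine tendsto_nhdsWithin_iff.2 ⟨?_, ?_⟩
    · have : Tendsto (fun ξ => 1 - sin ξ) (nhds (π / 2)) (nhds (1 - sin (π / 2))) :=
        Continuous.tendsto (by fun_prop) _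
      rw [sin_pi_div_two, sub_self] at this
      exact this.mono_left nhdsWithin_le_nhds
    · filter_upwards [hmem] with ξ hξ
      exact one_sub_sin_pos ⟨by linarith [hξ.1], hξ.2⟩
  refine tendsto_atTop_mono' _ ?_
    (h1.inv_tendsto_nhdsGT_zero.const_mul_atTop (by norm_num : (0 : ℝ) < 1 / 6))
  filter_upwards [hmem] with ξ hξ
  have := inv_one_sub_sin_le_modelPotential hk hξ
  simp only [Pi.inv_apply]
  linarith

theorem not_integrableOn_modelPotential_right {k c : ℝ} (hk : 1 / 4 < k)
    (hc : c ∈ Ioo (-(π / 2)) (π / 2)) : ¬ IntegrableOn (modelPotential k) (Ioo c (π / 2)) := by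
  have hpi := pi_pos
  have hmem : Ioo 0 (π / 2) ∈ nhdsWithin (π / 2) (Iio (π / 2)) := Ioo_mem_nhdsLT (by linarith)
  have hI : ∀ {ξ : ℝ}, ξ ∈ Ioo 0 (π / 2) → ξ ∈ Ioo (-(π / 2)) (π / 2) :=
    fun hξ => ⟨by linarith [hξ.1], hξ.2⟩
  refine not_integrableOn_of_tendsto_norm_atTop_of_deriv_isBigO_filter
    (l := nhdsWithin (π / 2) (Iio (π / 2))) (f := fun ξ => cos ξ / (1 - sin ξ))
    (Ioo_mem_nhdsLT hc.2) ?_ ?_ ?_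
  · filter_upwards [hmem] with ξ hξ
    exact (hasDerivAt_cos_div_one_sub_sin (hI hξ)).differentiableAt
  · refine tendsto_atTop_mono' _ ?_ tendsto_cos_pi_div_two.inv_tendsto_nhdsGT_zero
    filter_upwards [hmem] with ξ hξ
    have h1 := one_sub_sin_pos (hI hξ)
    have h2 := cos_pos_of_mem_Ioo (hI hξ)
    have h3 := sin_pos_of_pos_of_lt_pi hξ.1 (by linarith [hξ.2])
    rw [Real.norm_of_nonneg (by positivity), Pi.inv_apply, inv_eq_one_div, div_le_div_iff₀ h2 h1]
    nlinarith [sin_sq_add_cos_sq ξ]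
  · refine Asymptotics.IsBigO.of_bound 6 ?_
    filter_upwards [hmem] with ξ hξ
    rw [(hasDerivAt_cos_div_one_sub_sin (hI hξ)).deriv,
      Real.norm_of_nonneg (inv_nonneg.2 (one_sub_sin_pos (hI hξ)).le),
      Real.norm_of_nonneg (modelPotential_nonneg hk (hI hξ))]
    exact inv_one_sub_sin_le_modelPotential hk hξ

theorem not_integrableOn_modelPotential_left {k c : ℝ} (hk : 1 / 4 < k)
    (hc : c ∈ Ioo (-(π / 2)) (π / 2)) : ¬ IntegrableOn (modelPotential k) (Ioo (-(π / 2)) c) := by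
  have hpi := pi_pos
  have hmem : Ioo (-(π / 2)) 0 ∈ nhdsWithin (-(π / 2)) (Ioi (-(π / 2))) :=
    Ioo_mem_nhdsGT (by linarith)
  have hI : ∀ {ξ : ℝ}, ξ ∈ Ioo (-(π / 2)) 0 → ξ ∈ Ioo (-(π / 2)) (π / 2) :=
    fun hξ => ⟨hξ.1, by linarith [hξ.2]⟩
  refine not_integrableOn_of_tendsto_norm_atTop_of_deriv_isBigO_filter
    (l := nhdsWithin (-(π / 2)) (Ioi (-(π / 2)))) (f := fun ξ => cos ξ / (1 + sin ξ))
    (Ioo_mem_nhdsGT hc.1) ?_ ?_ ?_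
  · filter_upwards [hmem] with ξ hξ
    exact (hasDerivAt_cos_div_one_add_sin (hI hξ)).differentiableAt
  · refine tendsto_atTop_mono' _ ?_ tendsto_cos_neg_pi_div_two.inv_tendsto_nhdsGT_zero
    filter_upwards [hmem] with ξ hξ
    have h1 := one_add_sin_pos (hI hξ)
    have h2 := cos_pos_of_mem_Ioo (hI hξ)
    have h3 := sin_neg_of_neg_of_neg_pi_lt hξ.2 (by linarith [hξ.1])
    rw [Real.norm_of_nonneg (by positivity), Pi.inv_apply, inv_eq_one_div, div_le_div_iff₀ h2 h1]
    nlinarith [sin_sq_add_cos_sq ξ]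
  · refine Asymptotics.IsBigO.of_bound 2 ?_
    filter_upwards [hmem] with ξ hξ
    rw [(hasDerivAt_cos_div_one_add_sin (hI hξ)).deriv, norm_neg,
      Real.norm_of_nonneg (inv_nonneg.2 (one_add_sin_pos (hI hξ)).le),
      Real.norm_of_nonneg (modelPotential_nonneg hk (hI hξ))]
    exact inv_one_add_sin_le_modelPotential hk hξ

open scoped ContDiff in
theorem contDiffOn_of_linear_ode {s : Set ℝ} (hs : IsOpen s) {r φ φ' : ℝ → ℝ}
    (hr : ContDiffOn ℝ ∞ r s) (hφ : ∀ x ∈ s, HasDerivAt φ (φ' x) x)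
    (hφ' : ∀ x ∈ s, HasDerivAt φ' (r x * φ x) x) : ContDiffOn ℝ ∞ φ s := by
  have key : ∀ n : ℕ, ContDiffOn ℝ n φ s ∧ ContDiffOn ℝ n φ' s := by
    intro n
    induction n with
    | zero =>
      simp only [Nat.cast_zero, contDiffOn_zero]
      exact ⟨fun x hx => (hφ x hx).continuousAt.continuousWithinAt,
        fun x hx => (hφ' x hx).continuousAt.continuousWithinAt⟩
    | succ n ih =>
      push_cast
      rw [contDiffOn_succ_iff_deriv_of_isOpen hs, contDiffOn_succ_iff_deriv_of_isOpen hs]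
      refine ⟨⟨fun x hx => (hφ x hx).differentiableAt.differentiableWithinAt, by simp,
        ih.2.congr fun x hx => (hφ x hx).deriv⟩,
        fun x hx => (hφ' x hx).differentiableAt.differentiableWithinAt, by simp,
        ((hr.of_le (by exact_mod_cast le_top)).mul ih.1).congr fun x hx => (hφ' x hx).deriv⟩
  exact contDiffOn_infty.2 fun n => (key n).1

theorem hasDerivAt_Mfun {ℓ₁ : ℝ → ℝ} (hℓ₁ : ContinuousOn ℓ₁ (Icc 0 1)) {x : ℝ} (hx : x ∈ Ioo 0 1) :
    HasDerivAt (Mfun ℓ₁) (Mfun ℓ₁ x * ℓ₁ x) x := by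
  have h1 : HasDerivAt (fun x => ∫ t in (0 : ℝ)..x, ℓ₁ t) (ℓ₁ x) x := by
    refine intervalIntegral.integral_hasDerivAt_right ?_ ?_
      (hℓ₁.continuousAt (Icc_mem_nhds hx.1 hx.2))
    · refine (hℓ₁.mono ?_).intervalIntegrable
      rw [uIcc_of_le hx.1.le]
      exact Icc_subset_Icc_right hx.2.le
    · exact (hℓ₁.mono Ioo_subset_Icc_self).stronglyMeasurableAtFilter isOpen_Ioo x hx
  exact h1.exp

theorem hasDerivAt_rpow_mul_rpow_mul_Mfun {ℓ₁ : ℝ → ℝ} (hℓ₁ : ContinuousOn ℓ₁ (Icc 0 1)) {x : ℝ}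
    (hx : x ∈ Ioo 0 1) (α β : ℝ) :
    HasDerivAt (fun x => x ^ α * (1 - x) ^ β * Mfun ℓ₁ x)
      ((α / x - β / (1 - x) + ℓ₁ x) * (x ^ α * (1 - x) ^ β * Mfun ℓ₁ x)) x := by
  have h0 : x ≠ 0 := hx.1.ne'
  have h1 : 1 - x ≠ 0 := (sub_pos.2 hx.2).ne'
  refine (((hasDerivAt_rpow_const (p := α) (Or.inl h0)).mul
    (((hasDerivAt_id x).const_sub 1).rpow_const (p := β) (Or.inl h1))).mul
    (hasDerivAt_Mfun hℓ₁ hx)).congr_deriv ?_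
  simp only [id, Pi.mul_apply]
  rw [rpow_sub_one h0, rpow_sub_one h1]
  field_simp
  ring

theorem rpow_mul_rpow_mul_Mfun_pos (ℓ₁ : ℝ → ℝ) {x : ℝ} (hx : x ∈ Ioo 0 1) (α β : ℝ) :
    0 < x ^ α * (1 - x) ^ β * Mfun ℓ₁ x :=
  mul_pos (mul_pos (rpow_pos_of_pos hx.1 _) (rpow_pos_of_pos (sub_pos.2 hx.2) _)) (exp_pos _)

theorem logDeriv_afun {ℓ₁ : ℝ → ℝ} (hℓ₁ : ContinuousOn ℓ₁ (Icc 0 1)) (N : ℝ) {x : ℝ}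
    (hx : x ∈ Ioo 0 1) :
    deriv (afun N ℓ₁) x / afun N ℓ₁ x = 5 / 2 / x - N / 2 / (1 - x) + ℓ₁ x := by
  have h := hasDerivAt_rpow_mul_rpow_mul_Mfun hℓ₁ hx (5 / 2) (N / 2)
  have hpos := rpow_mul_rpow_mul_Mfun_pos ℓ₁ hx (5 / 2) (N / 2)
  rw [div_eq_iff (show afun N ℓ₁ x ≠ 0 from hpos.ne')]
  exact h.deriv

theorem logDeriv_bfun {ℓ₁ : ℝ → ℝ} (hℓ₁ : ContinuousOn ℓ₁ (Icc 0 1)) (N : ℝ) {x : ℝ}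
    (hx : x ∈ Ioo 0 1) :
    deriv (bfun N ℓ₁) x / bfun N ℓ₁ x = 3 / 2 / x - (N / 2 - 1) / (1 - x) + ℓ₁ x := by
  have h := hasDerivAt_rpow_mul_rpow_mul_Mfun hℓ₁ hx (3 / 2) (N / 2 - 1)
  have hpos := rpow_mul_rpow_mul_Mfun_pos ℓ₁ hx (3 / 2) (N / 2 - 1)
  rw [div_eq_iff (show bfun N ℓ₁ x ≠ 0 from hpos.ne')]
  exact h.deriv

theorem afun_div_bfun (N : ℝ) (ℓ₁ : ℝ → ℝ) {x : ℝ} (hx : x ∈ Ioo 0 1) :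
    afun N ℓ₁ x / bfun N ℓ₁ x = x * (1 - x) := by
  have h1 : 0 < 1 - x := sub_pos.2 hx.2
  have hpos := rpow_mul_rpow_mul_Mfun_pos ℓ₁ hx (3 / 2) (N / 2 - 1)
  rw [div_eq_iff (show bfun N ℓ₁ x ≠ 0 from hpos.ne')]
  have e1 : x ^ ((5 : ℝ) / 2) = x ^ ((3 : ℝ) / 2) * x := by
    rw [← rpow_add_one hx.1.ne']
    norm_num
  have e2 : (1 - x) ^ (N / 2) = (1 - x) ^ (N / 2 - 1) * (1 - x) := by
    rw [← rpow_add_one h1.ne', sub_add_cancel]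
  rw [afun, bfun, e1, e2]
  ring

theorem Rfun_eq {ℓ₁ : ℝ → ℝ} (hℓ₁ : ContinuousOn ℓ₁ (Icc 0 1)) (N : ℝ) {x : ℝ} (hx : x ∈ Ioo 0 1) :
    Rfun N ℓ₁ x = 4 * x⁻¹ - (N - 1) * (1 - x)⁻¹ + 2 * ℓ₁ x := by
  have h1 : 1 - x ≠ 0 := (sub_pos.2 hx.2).ne'
  have h0 : x ≠ 0 := hx.1.ne'
  rw [Rfun, logDeriv_afun hℓ₁ N hx, logDeriv_bfun hℓ₁ N hx]
  field_simp
  ring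

theorem deriv_Rfun {ℓ₁ : ℝ → ℝ} (hℓ₁ : AnalyticOnNhd ℝ ℓ₁ (Icc 0 1)) (N : ℝ) {x : ℝ}
    (hx : x ∈ Ioo 0 1) :
    deriv (Rfun N ℓ₁) x = -4 / x ^ 2 - (N - 1) / (1 - x) ^ 2 + 2 * deriv ℓ₁ x := by
  have h1 : 1 - x ≠ 0 := (sub_pos.2 hx.2).ne'
  have h0 : x ≠ 0 := hx.1.ne'
  have hd : HasDerivAt (fun x => 4 * x⁻¹ - (N - 1) * (1 - x)⁻¹ + 2 * ℓ₁ x)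
      (-4 / x ^ 2 - (N - 1) / (1 - x) ^ 2 + 2 * deriv ℓ₁ x) x := by
    refine ((((hasDerivAt_inv h0).const_mul 4).sub
      ((((hasDerivAt_id x).const_sub 1).inv h1).const_mul (N - 1))).add
      ((hℓ₁ x (Ioo_subset_Icc_self hx)).differentiableAt.hasDerivAt.const_mul 2)).congr_deriv ?_
    simp only [id]
    ring
  refine (hd.congr_of_eventuallyEq ?_).deriv
  filter_upwards [isOpen_Ioo.mem_nhds hx] with y hy using Rfun_eq hℓ₁.continuousOn N hy

/-- The regular part of the Liouville potential, as a function of `x`. -/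
noncomputable def regularPart (N : ℝ) (ℓ₁ L₀ : ℝ → ℝ) (x : ℝ) : ℝ :=
  L₀ x + (1 / 4) * (5 * ℓ₁ x * (1 - x) - N * ℓ₁ x * x +
    x * (1 - x) * (ℓ₁ x ^ 2 + 2 * deriv ℓ₁ x)) - (5 * N - 1) / 8 - (5 * ((N - 3) / 4) - 1) / 2

theorem analyticOnNhd_regularPart (N : ℝ) {ℓ₁ L₀ : ℝ → ℝ} (hℓ₁ : AnalyticOnNhd ℝ ℓ₁ (Icc 0 1))
    (hL₀ : AnalyticOnNhd ℝ L₀ (Icc 0 1)) : AnalyticOnNhd ℝ (regularPart N ℓ₁ L₀) (Icc 0 1) := by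
  intro x hx
  have h1 := hℓ₁ x hx
  have h2 := hL₀ x hx
  have h3 := h1.deriv
  unfold regularPart
  fun_prop

theorem qfun_eq (N : ℝ) {ℓ₁ : ℝ → ℝ} (L₀ : ℝ → ℝ) (hℓ₁ : AnalyticOnNhd ℝ ℓ₁ (Icc 0 1)) {ξ : ℝ}
    (hξ : ξ ∈ Ioo (-(π / 2)) (π / 2)) :
    qfun N ℓ₁ L₀ ξ =
      modelPotential ((N - 3) / 4) ξ + regularPart N ℓ₁ L₀ ((1 + sin ξ) / 2) := by
  have h1 := one_add_sin_pos hξ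
  have h2 := one_sub_sin_pos hξ
  set x := (1 + sin ξ) / 2 with hx
  have hxI : x ∈ Ioo (0 : ℝ) 1 := ⟨by linarith, by linarith⟩
  have hs : sin ξ = 2 * x - 1 := by rw [hx]; ring
  have h3 : x ≠ 0 := hxI.1.ne'
  have h4 : 1 - x ≠ 0 := (sub_pos.2 hxI.2).ne'
  have e1 : (1 + sin ξ)⁻¹ = x⁻¹ / 2 := by rw [hx, inv_div]; field_simp
  have e2 : (1 - sin ξ)⁻¹ = (1 - x)⁻¹ / 2 := by
    rw [hs, show 1 - (2 * x - 1) = 2 * (1 - x) by ring, mul_inv]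
    ring
  rw [qfun, ← hx, Qfun, afun_div_bfun N ℓ₁ hxI, deriv_Rfun hℓ₁ N hxI,
    Rfun_eq hℓ₁.continuousOn N hxI, logDeriv_afun hℓ₁.continuousOn N hxI, modelPotential, e1, e2,
    regularPart]
  field_simp
  ring

open scoped ContDiff in
theorem contDiff_regularPart_comp (N : ℝ) {ℓ₁ L₀ : ℝ → ℝ} (hℓ₁ : AnalyticOnNhd ℝ ℓ₁ (Icc 0 1))
    (hL₀ : AnalyticOnNhd ℝ L₀ (Icc 0 1)) :
    ContDiff ℝ ∞ fun ξ => regularPart N ℓ₁ L₀ ((1 + sin ξ) / 2) := by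
  refine contDiff_iff_contDiffAt.2 fun ξ => ?_
  have h : (1 + sin ξ) / 2 ∈ Icc (0 : ℝ) 1 :=
    ⟨by linarith [neg_one_le_sin ξ], by linarith [sin_le_one ξ]⟩
  have h1 : ContDiffAt ℝ ∞ (regularPart N ℓ₁ L₀) ((1 + sin ξ) / 2) :=
    (analyticOnNhd_regularPart N hℓ₁ hL₀ _ h).contDiffAt
  exact h1.comp ξ ((contDiff_const.add contDiff_sin).div_const 2).contDiffAt

theorem exists_abs_regularPart_comp_le (N : ℝ) {ℓ₁ L₀ : ℝ → ℝ}
    (hℓ₁ : AnalyticOnNhd ℝ ℓ₁ (Icc 0 1)) (hL₀ : AnalyticOnNhd ℝ L₀ (Icc 0 1)) :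
    ∃ c, ∀ ξ, |regularPart N ℓ₁ L₀ ((1 + sin ξ) / 2)| ≤ c := by
  obtain ⟨c, hc⟩ := isCompact_Icc.exists_bound_of_continuousOn
    (analyticOnNhd_regularPart N hℓ₁ hL₀).continuousOn
  exact ⟨c, fun ξ => hc _ ⟨by linarith [neg_one_le_sin ξ], by linarith [sin_le_one ξ]⟩⟩

/-- (Proposition 7, concrete form.)  The Schrödinger operator `−d²/dξ² + q` on
`(−π/2, π/2)` has a strictly increasing sequence of simple eigenvalues `λₙ → +∞` whose
eigenfunctions form an orthonormal Hilbert basis of `L²(−π/2, π/2)` and have finite energy,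
and every finite-energy `L²` solution of `−η'' + qη = λη` is a multiple of one of them (or
vanishes). -/
theorem spectral_decomposition (N : ℝ) (hN : 4 < N)
    (ℓ₁ L₀ : ℝ → ℝ)
    (hℓ₁ : AnalyticOnNhd ℝ ℓ₁ (Icc 0 1))
    (hL₀ : AnalyticOnNhd ℝ L₀ (Icc 0 1)) :
    ∃ lam : ℕ → ℝ, ∃ φ : ℕ → ℝ → ℝ,
      StrictMono lam ∧
      Tendsto lam atTop atTop ∧
      -- each φₙ is smooth on (−π/2, π/2), square integrable, and an eigenfunction
      (∀ n : ℕ, ContDiffOn ℝ (⊤ : ℕ∞) (φ n) (Ioo (-(π/2)) (π/2))) ∧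
      (∀ n : ℕ, IntegrableOn (fun ξ => (φ n ξ) ^ 2) (Ioo (-(π/2)) (π/2))) ∧
      (∀ n : ℕ, ∀ ξ ∈ Ioo (-(π/2)) (π/2),
        -deriv (deriv (φ n)) ξ + qfun N ℓ₁ L₀ ξ * φ n ξ = lam n * φ n ξ) ∧
      -- (ii) orthonormality and completeness in L²(−π/2, π/2)
      (∀ m n : ℕ, (∫ ξ in Ioo (-(π/2)) (π/2), φ m ξ * φ n ξ)
        = if m = n then 1 else 0) ∧
      (∀ g : ℝ → ℝ, IntegrableOn (fun ξ => (g ξ) ^ 2) (Ioo (-(π/2)) (π/2)) →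
        Measurable g →
        (∀ n : ℕ, (∫ ξ in Ioo (-(π/2)) (π/2), g ξ * φ n ξ) = 0) →
        ∀ᵐ ξ ∂(MeasureTheory.volume.restrict (Ioo (-(π/2)) (π/2))), g ξ = 0) ∧
      -- (iii) finite energy
      (∀ n : ℕ, IntegrableOn
        (fun ξ => (deriv (φ n) ξ) ^ 2 + qfun N ℓ₁ L₀ ξ * (φ n ξ) ^ 2)
        (Ioo (-(π/2)) (π/2))) ∧
      -- (iv) simplicity of the eigenvalues
      (∀ lam' : ℝ, ∀ η : ℝ → ℝ,
        ContDiffOn ℝ 2 η (Ioo (-(π/2)) (π/2)) →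
        IntegrableOn (fun ξ => (η ξ) ^ 2) (Ioo (-(π/2)) (π/2)) →
        IntegrableOn (fun ξ => (deriv η ξ) ^ 2 + qfun N ℓ₁ L₀ ξ * (η ξ) ^ 2)
          (Ioo (-(π/2)) (π/2)) →
        (∀ ξ ∈ Ioo (-(π/2)) (π/2),
          -deriv (deriv η) ξ + qfun N ℓ₁ L₀ ξ * η ξ = lam' * η ξ) →
        (∃ n : ℕ, ∃ c : ℝ, lam' = lam n ∧
          ∀ ξ ∈ Ioo (-(π/2)) (π/2), η ξ = c * φ n ξ) ∨
        (∀ ξ ∈ Ioo (-(π/2)) (π/2), η ξ = 0)) := by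
  set I := Ioo (-(π / 2)) (π / 2) with hI
  set k := (N - 3) / 4 with hk
  have hk' : 1 / 4 < k := by rw [hk]; linarith
  set p := modelPotential k with hp
  set v : ℝ → ℝ := fun ξ => regularPart N ℓ₁ L₀ ((1 + sin ξ) / 2) with hv
  have hvs := contDiff_regularPart_comp N hℓ₁ hL₀
  obtain ⟨c, hc⟩ := exists_abs_regularPart_comp_le N hℓ₁ hL₀
  have hq : ∀ ξ ∈ I, qfun N ℓ₁ L₀ ξ = p ξ + v ξ := fun ξ hξ => qfun_eq N L₀ hℓ₁ hξ
  have hvm : AEStronglyMeasurable v (volume.restrict I) := hvs.continuous.aestronglyMeasurable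
  have hvi : ∀ {f : ℝ → ℝ}, IntegrableOn (fun ξ => f ξ ^ 2) I →
      IntegrableOn (fun ξ => v ξ * f ξ ^ 2) I := fun hf =>
    hf.bdd_mul hvm (Eventually.of_forall hc)
  obtain ⟨κ, φ, φ', hκ, hκt, hφ, hφ2, hφo, hφc, hφs⟩ :=
    (isIncreasingSolution_model hk').exists_energy_eigenbasis
      (fun _ => not_integrableOn_modelPotential_left hk')
      (fun _ => not_integrableOn_modelPotential_right hk') (tendsto_modelPotential hk')
      (w := fun ξ => v ξ + c) (hvs.continuous.add continuous_const).continuousOn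
      (fun ξ _ => by linarith [(abs_le.1 (hc ξ)).1]) (C := c + c)
      (fun ξ _ => by linarith [(abs_le.1 (hc ξ)).2])
  have hd : ∀ n, ∀ ξ ∈ I, deriv (φ n) ξ = φ' n ξ := fun n ξ hξ => ((hφ n).hasDerivAt ξ hξ).deriv
  refine ⟨fun n => κ n - c, φ, fun m n hmn => sub_lt_sub_right (hκ hmn) c,
    tendsto_atTop_add_const_right _ (-c) hκt, fun n => ?_, hφ2, fun n ξ hξ => ?_, hφo,
    fun g hg2 hg hgn => ?_, fun n => ?_, fun μ η hη hη2 hηe hηq => ?_⟩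
  · refine contDiffOn_of_linear_ode isOpen_Ioo ?_ (hφ n).hasDerivAt (hφ n).hasDerivAt_deriv
    exact ((contDiffOn_modelPotential k).add (hvs.add contDiff_const).contDiffOn).sub
      contDiffOn_const
  · have h : deriv (deriv (φ n)) ξ = (p ξ + (v ξ + c) - κ n) * φ n ξ := by
      refine (((hφ n).hasDerivAt_deriv ξ hξ).congr_of_eventuallyEq ?_).deriv
      filter_upwards [isOpen_Ioo.mem_nhds hξ] with y hy using hd n y hy
    rw [h, hq ξ hξ]
    ring
  · exact hφc g ((memLp_two_iff_integrable_sq hg.aestronglyMeasurable).2 hg2) hgn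
  · refine ((hφ n).energy.add (hvi (hφ2 n))).congr_fun (fun ξ hξ => ?_) measurableSet_Ioo
    simp only [Pi.add_apply, hd n ξ hξ, hq ξ hξ]
    ring
  · have h2 := (contDiffOn_succ_iff_deriv_of_isOpen (n := 1) isOpen_Ioo).1 hη
    have h3 := (contDiffOn_succ_iff_deriv_of_isOpen (n := 0) isOpen_Ioo).1 h2.2.2
    have hηs : IsEnergySolution (-(π / 2)) (π / 2) p (fun ξ => p ξ + (v ξ + c) - (μ + c)) η
        (deriv η) := by
      refine ⟨fun ξ hξ => (h2.1.differentiableAt (isOpen_Ioo.mem_nhds hξ)).hasDerivAt,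
        fun ξ hξ => (h3.1.differentiableAt (isOpen_Ioo.mem_nhds hξ)).hasDerivAt.congr_deriv ?_, ?_⟩
      · have := hηq ξ hξ
        rw [hq ξ hξ] at this
        linarith
      · refine (hηe.sub (hvi hη2)).congr_fun (fun ξ hξ => ?_) measurableSet_Ioo
        simp only [Pi.sub_apply, hq ξ hξ]
        ring
    rcases hφs (μ + c) η (deriv η) hηs hη2 with ⟨n, d, hμ, hd⟩ | h0
    · exact Or.inl ⟨n, d, by linarith, hd⟩
    · exact Or.inr h0
end
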